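/- arXiv:1712.00716 — 2 statements merged into one kernel-verified Lean document; each statement's English description precedes it below -/
import Mathlib

section
/- There exist positive numerical constants c₀, c₁, c₂, C such that for every δ ∈ (0,1) and every x ∈ ℂ^n with ‖x‖ = 1, setting γ := c₀ δ³ (log n)^{−6}, whenever m ≥ C · max{‖C_x‖² (log n)¹⁷, δ^{−2} n (log n)⁴}, with probability at least 1 − c₁ m^{−c₂} over a ∼ CN(0, I_m) the following holds: for every w ∈ ℂ^n with ‖w‖ ≤ γ, one has ‖(A x) ∘ 1_{|A w| ≥ |A x|}‖ ≤ δ √m ‖w‖, where 1_{|A w| ≥ |A x|} ∈ {0,1}^m is the entrywise indicator vector of the set {k : |(A w)_k| ≥ |(A x)_k|}. -/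
open MeasureTheory ProbabilityTheory Matrix Complex
open scoped NNReal ENNReal

noncomputable section

namespace ConvPR

/-- The complex Gaussian distribution `CN(0, σ²)` on `ℂ`, as the pushforward of the
product of two real Gaussians `N(0, σ²/2)` under `(u, v) ↦ u + i v`. -/
def cgaussian (σ2 : ℝ) : Measure ℂ :=
  Measure.map (fun p : ℝ × ℝ => (p.1 : ℂ) + (p.2 : ℂ) * Complex.I)
    ((gaussianReal 0 (σ2 / 2).toNNReal).prod (gaussianReal 0 (σ2 / 2).toNNReal))

/-- The complex Gaussian `CN(0, σ² I_m)` on `Fin m → ℂ`. -/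
def cgaussianVec (m : ℕ) (σ2 : ℝ) : Measure (Fin m → ℂ) :=
  Measure.pi fun _ => cgaussian σ2

/-- The Euclidean norm on `Fin k → ℂ`. -/
def cnorm {k : ℕ} (v : Fin k → ℂ) : ℝ := Real.sqrt (∑ i, ‖v i‖ ^ 2)

/-- The Euclidean norm on `Fin k → ℝ`. -/
def rnorm {k : ℕ} (v : Fin k → ℝ) : ℝ := Real.sqrt (∑ i, v i ^ 2)

/-- The operator (spectral) norm of a complex matrix. -/
def opNorm {k l : ℕ} (M : Matrix (Fin k) (Fin l) ℂ) : ℝ :=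
  sSup {r : ℝ | ∃ v : Fin l → ℂ, cnorm v ≤ 1 ∧ r = cnorm (M.mulVec v)}

/-- Zero-padding `ℂ^n → ℂ^m`. -/
def pad {n : ℕ} (m : ℕ) (x : Fin n → ℂ) : Fin m → ℂ :=
  fun i => if hi : (i : ℕ) < n then x ⟨(i : ℕ), hi⟩ else 0

/-- The `m × n` matrix `A` formed by the first `n` columns of the circulant matrix `C_a`,
so that `A x = a ⊛ x`. -/
def Amat {n m : ℕ} (h : n ≤ m) (a : Fin m → ℂ) : Matrix (Fin m) (Fin n) ℂ :=
  Matrix.of fun i j => Matrix.circulant a i (Fin.castLE h j)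

/-- The circulant matrix `C_x` generated by the zero-padding of `x`. -/
def Cx {n : ℕ} (m : ℕ) (x : Fin n → ℂ) : Matrix (Fin m) (Fin m) ℂ :=
  Matrix.circulant (pad m x)

/-- `exp (i φ(u)) = u / |u|` for `u ≠ 0`, and `1` for `u = 0`. -/
def phase (u : ℂ) : ℂ := if u = 0 then 1 else u / (‖u‖ : ℂ)

/-- `ζ_{σ²}(t) = 1 − exp (−|t|² / (2σ²))`. -/
def zeta (σ2 : ℝ) (t : ℂ) : ℝ := 1 - Real.exp (-‖t‖ ^ 2 / (2 * σ2))

/-- `dist (z, X)` where `X = { x e^{iθ} : θ ∈ [0, 2π) }`. -/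
def distX {n : ℕ} (x z : Fin n → ℂ) : ℝ :=
  sInf {r : ℝ | ∃ θ ∈ Set.Ico (0 : ℝ) (2 * Real.pi),
    r = cnorm (z - Complex.exp ((θ : ℂ) * Complex.I) • x)}

/-- `y = |A x|`. -/
def yvec {n m : ℕ} (h : n ≤ m) (x : Fin n → ℂ) (a : Fin m → ℂ) : Fin m → ℝ :=
  fun k => ‖(Amat h a).mulVec x k‖

/-- The Hermitian inner product `x^* z`. -/
def dotc {n : ℕ} (x z : Fin n → ℂ) : ℂ := ∑ i, starRingEnd ℂ (x i) * z i

/-- `ψ(t) = exp (−2 i φ(t))`. -/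
def psi (t : ℂ) : ℂ := starRingEnd ℂ (phase t) ^ 2

/-- The Gaussian smoothing `h(t) = E_{s ∼ CN(0,1)} [ψ(t+s)]`. -/
def hfun (t : ℂ) : ℂ := ∫ s, psi (t + s) ∂(cgaussian 1)

/-- `Δ_∞(ε) = (1 + 2σ²) · sup_t |(1+ε) h(t) − ζ_{σ²}(t) ψ(t)|`. -/
def DeltaInf (σ2 ε : ℝ) : ℝ :=
  (1 + 2 * σ2) *
    sSup {r : ℝ | ∃ t : ℂ, r = ‖((1 + ε : ℝ) : ℂ) * hfun t - ((zeta σ2 t : ℝ) : ℂ) * psi t‖}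

/-- The generalized (Wirtinger) gradient of the weighted amplitude objective. -/
def grad {n m : ℕ} (h : n ≤ m) (σ2 : ℝ) (x : Fin n → ℂ) (a : Fin m → ℂ)
    (z : Fin n → ℂ) : Fin n → ℂ :=
  ((1 / (m : ℝ) : ℝ) : ℂ) •
    (Amat h a)ᴴ.mulVec fun k =>
      ((zeta σ2 ((yvec h x a k : ℝ) : ℂ) : ℝ) : ℂ) *
        ((Amat h a).mulVec z k - ((yvec h x a k : ℝ) : ℂ) * phase ((Amat h a).mulVec z k))

/-- The spectral-method matrix `Y = (1/m) A^* diag(y²) A`. -/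
def Ymat {n m : ℕ} (h : n ≤ m) (x : Fin n → ℂ) (a : Fin m → ℂ) :
    Matrix (Fin n) (Fin n) ℂ :=
  ((1 / (m : ℝ) : ℝ) : ℂ) •
    ((Amat h a)ᴴ * Matrix.diagonal (fun k => ((yvec h x a k ^ 2 : ℝ) : ℂ)) * Amat h a)

/-- The norm estimate `λ = sqrt((1/m) ∑ y_k²)`. -/
def lam {n m : ℕ} (h : n ≤ m) (x : Fin n → ℂ) (a : Fin m → ℂ) : ℝ :=
  Real.sqrt ((1 / (m : ℝ)) * ∑ k, yvec h x a k ^ 2)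

/-- `v` is a unit-norm eigenvector of `Y` associated with its largest eigenvalue. -/
def IsTopEigenvector {n : ℕ} (Y : Matrix (Fin n) (Fin n) ℂ) (v : Fin n → ℂ) : Prop :=
  cnorm v = 1 ∧ ∃ μ : ℝ, Y.mulVec v = (μ : ℂ) • v ∧
    ∀ μ' : ℝ, (∃ w : Fin n → ℂ, w ≠ 0 ∧ Y.mulVec w = (μ' : ℂ) • w) → μ' ≤ μ

/-- `M = ((2σ²+1)/m) A^* diag(ζ_{σ²}(y)) A`. -/
def Mmat {n m : ℕ} (h : n ≤ m) (σ2 : ℝ) (x : Fin n → ℂ) (a : Fin m → ℂ) :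
    Matrix (Fin n) (Fin n) ℂ :=
  (((2 * σ2 + 1) / (m : ℝ) : ℝ) : ℂ) •
    ((Amat h a)ᴴ *
      Matrix.diagonal (fun k => ((zeta σ2 ((yvec h x a k : ℝ) : ℂ) : ℝ) : ℂ)) * Amat h a)

/-- The vector `d(z)` from the contraction analysis. -/
def dvec {n m : ℕ} (h : n ≤ m) (σ2 : ℝ) (x : Fin n → ℂ) (a : Fin m → ℂ)
    (z : Fin n → ℂ) (θ : ℝ) : Fin n → ℂ :=
  (1 - Mmat h σ2 x a).mulVec (z - Complex.exp ((θ : ℂ) * Complex.I) • x)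
    - Complex.exp ((θ : ℂ) * Complex.I) • (Mmat h σ2 x a).mulVec x
    + (((2 * σ2 + 1) / (m : ℝ) : ℝ) : ℂ) •
        (Amat h a)ᴴ.mulVec fun k =>
          ((zeta σ2 ((yvec h x a k : ℝ) : ℂ) : ℝ) : ℂ) *
            (((yvec h x a k : ℝ) : ℂ) * phase ((Amat h a).mulVec z k))

/-- Projection onto the orthogonal complement of a unit vector `x`. -/
def projPerp {n : ℕ} (x v : Fin n → ℂ) : Fin n → ℂ := v - dotc x v • x

/-- Projection onto the span of a unit vector `x`. -/
def projPar {n : ℕ} (x v : Fin n → ℂ) : Fin n → ℂ := dotc x v • x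

/-- The matrix `P_{x⊥} = I − x x^*`. -/
def Pperp {n : ℕ} (x : Fin n → ℂ) : Matrix (Fin n) (Fin n) ℂ :=
  1 - Matrix.vecMulVec x (star x)

/-- `T = (1/m) R_{[1:n]} C_g^* diag(b) C_g R_{[1:n]}ᵀ`. -/
def Tmat {n m : ℕ} (h : n ≤ m) (b : Fin m → ℝ) (g : Fin m → ℂ) :
    Matrix (Fin n) (Fin n) ℂ :=
  ((1 / (m : ℝ) : ℝ) : ℂ) •
    (((Matrix.circulant g)ᴴ * Matrix.diagonal (fun k => ((b k : ℝ) : ℂ)) *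
        Matrix.circulant g).submatrix (Fin.castLE h) (Fin.castLE h))

/-- `L(g) = ‖T − (1/m)(∑ b_k) I‖`. -/
def Lfun {n m : ℕ} (h : n ≤ m) (b : Fin m → ℝ) (g : Fin m → ℂ) : ℝ :=
  opNorm (Tmat h b g -
    (((1 / (m : ℝ)) * ∑ k, b k : ℝ) : ℂ) • (1 : Matrix (Fin n) (Fin n) ℂ))

/-- `G = R_{[1:n]} C_g^*`. -/
def Gmat {n m : ℕ} (h : n ≤ m) (g : Fin m → ℂ) : Matrix (Fin n) (Fin m) ℂ :=
  ((Matrix.circulant g)ᴴ).submatrix (Fin.castLE h) id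

/-- `ξ_{σ²}(t) = (1/(2πσ²)) exp(−|t|²/(2σ²))`. -/
def xiF (σ2 : ℝ) (t : ℂ) : ℝ :=
  (1 / (2 * Real.pi * σ2)) * Real.exp (-‖t‖ ^ 2 / (2 * σ2))

/-- `ζ_{σ²}(t) = 1 − 2πσ² ξ_{σ²}(t)`. -/
def zetaF (σ2 : ℝ) (t : ℂ) : ℝ := 1 - 2 * Real.pi * σ2 * xiF σ2 t

/-- `η_{σ²}(t) = 1 − 2πσ² ξ_{σ²−1/2}(t)`. -/
def etaF (σ2 : ℝ) (t : ℂ) : ℝ := 1 - 2 * Real.pi * σ2 * xiF (σ2 - 1 / 2) t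

/-- `ν_{σ²}(t) = 1 − (4πσ⁴/(2σ²−1)) ξ_{σ²−1/2}(t)`. -/
def nuF (σ2 : ℝ) (t : ℂ) : ℝ :=
  1 - (4 * Real.pi * σ2 ^ 2 / (2 * σ2 - 1)) * xiF (σ2 - 1 / 2) t

/-- `g(t) = E_{v₁,v₂ ∼ N(0,1/2)} [((|t|+v₁)² − v₂²)/((|t|+v₁)² + v₂²)]`. -/
def gfun (t : ℂ) : ℝ :=
  ∫ p : ℝ × ℝ, ((‖t‖ + p.1) ^ 2 - p.2 ^ 2) / ((‖t‖ + p.1) ^ 2 + p.2 ^ 2)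
    ∂((gaussianReal 0 (1 / 2 : ℝ≥0)).prod (gaussianReal 0 (1 / 2 : ℝ≥0)))

lemma measurable_cgaussian_map :
    Measurable (fun p : ℝ × ℝ => (p.1 : ℂ) + (p.2 : ℂ) * Complex.I) := by fun_prop

instance (s : ℝ) : IsProbabilityMeasure (cgaussian s) :=
  Measure.isProbabilityMeasure_map measurable_cgaussian_map.aemeasurable

instance (m : ℕ) (s : ℝ) : IsProbabilityMeasure (cgaussianVec m s) := by
  unfold cgaussianVec; infer_instance

/-- Characteristic function of `CN(0, 1)`. -/
lemma integral_cgaussian_char (p : ℂ) :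
    ∫ z, cexp (((p * z).re : ℝ) * I) ∂(cgaussian 1) = cexp (-(‖p‖ ^ 2 / 4 : ℝ)) := by
  have hg : ∀ t : ℝ, ∫ x : ℝ, cexp (t * x * I) ∂(gaussianReal 0 (1 / 2 : ℝ).toNNReal) =
      cexp (-(t ^ 2 / 4 : ℝ)) := by
    intro t
    have := charFun_gaussianReal (μ := 0) (v := (1 / 2 : ℝ).toNNReal) t
    rw [charFun_apply_real] at this
    rw [this]
    congr 1
    push_cast [Real.coe_toNNReal (1 / 2) (by norm_num)]
    ring
  rw [cgaussian, integral_map measurable_cgaussian_map.aemeasurable (by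
    apply Continuous.aestronglyMeasurable; fun_prop)]
  have hsplit : ∀ q : ℝ × ℝ, cexp (((p * ((q.1 : ℂ) + (q.2 : ℂ) * I)).re : ℝ) * I) =
      cexp (p.re * q.1 * I) * cexp ((-p.im : ℝ) * q.2 * I) := by
    intro q
    rw [← Complex.exp_add]
    congr 1
    simp
    ring
  simp_rw [hsplit]
  rw [integral_prod_mul (fun x : ℝ => cexp (p.re * x * I))
    (fun y : ℝ => cexp ((-p.im : ℝ) * y * I)), hg, hg, ← Complex.exp_add]
  congr 1
  rw [← Complex.normSq_eq_norm_sq, Complex.normSq_apply]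
  push_cast
  ring

/-- Characteristic function of `CN(0, I_m)`. -/
lemma integral_cgaussianVec_char {m : ℕ} (p : Fin m → ℂ) :
    ∫ a, cexp (((∑ l, p l * a l).re : ℝ) * I) ∂(cgaussianVec m 1) =
      cexp (-((∑ l, ‖p l‖ ^ 2) / 4 : ℝ)) := by
  have : ∀ a : Fin m → ℂ, cexp (((∑ l, p l * a l).re : ℝ) * I) =
      ∏ l, cexp (((p l * a l).re : ℝ) * I) := by
    intro a
    rw [← Complex.exp_sum, Complex.re_sum, ← Finset.sum_mul]
    push_cast
    rfl
  simp_rw [this]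
  rw [cgaussianVec, integral_fintype_prod_eq_prod
    (fun l z => cexp (((p l * z).re : ℝ) * I))]
  simp_rw [integral_cgaussian_char]
  rw [← Complex.exp_sum]
  congr 1
  push_cast
  rw [Finset.sum_neg_distrib, Finset.sum_div]

lemma exists_dual_complex (L : StrongDual ℝ ℂ) : ∃ p : ℂ, ∀ z, L z = (p * z).re := by
  refine ⟨⟨L 1, -L I⟩, fun z => ?_⟩
  have : z = z.re • (1 : ℂ) + z.im • I := by simp
  conv_lhs => rw [this]
  rw [map_add, map_smul, map_smul]
  simp
  ring

lemma exists_dual_pi {m : ℕ} (L : StrongDual ℝ (Fin m → ℂ)) :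
    ∃ p : Fin m → ℂ, ∀ a, L a = (∑ l, p l * a l).re := by
  choose p hp using fun l => exists_dual_complex
    (L.comp (ContinuousLinearMap.single ℝ (fun _ : Fin m => ℂ) l))
  refine ⟨p, fun a => ?_⟩
  have : a = ∑ l, Pi.single l (a l) := (Finset.univ_sum_single a).symm
  conv_lhs => rw [this]
  rw [map_sum, Complex.re_sum]
  exact Finset.sum_congr rfl fun l _ => hp l (a l)

lemma charFunDual_cgaussian (L : StrongDual ℝ ℂ) (p : ℂ) (hp : ∀ z, L z = (p * z).re) :
    charFunDual (cgaussian 1) L = cexp (-(‖p‖ ^ 2 / 4 : ℝ)) := by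
  rw [charFunDual_apply, ← integral_cgaussian_char]
  simp_rw [hp]

lemma charFunDual_cgaussianVec {m : ℕ} (L : StrongDual ℝ (Fin m → ℂ)) (p : Fin m → ℂ)
    (hp : ∀ a, L a = (∑ l, p l * a l).re) :
    charFunDual (cgaussianVec m 1) L = cexp (-((∑ l, ‖p l‖ ^ 2) / 4 : ℝ)) := by
  rw [charFunDual_apply, ← integral_cgaussianVec_char]
  simp_rw [hp]

/-- A unit-norm linear form of a standard complex Gaussian vector is standard complex Gaussian. -/
lemma map_linearForm_cgaussianVec {m : ℕ} (c : Fin m → ℂ) (hc : ∑ l, ‖c l‖ ^ 2 = 1) :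
    (cgaussianVec m 1).map (fun a => ∑ l, c l * a l) = cgaussian 1 := by
  let T : (Fin m → ℂ) →L[ℝ] ℂ :=
    ∑ l, (ContinuousLinearMap.mul ℝ ℂ (c l)).comp
      (ContinuousLinearMap.proj (R := ℝ) (φ := fun _ : Fin m => ℂ) l)
  have hT : ∀ a, T a = ∑ l, c l * a l := fun a => by simp [T]
  have hT' : (fun a : Fin m → ℂ => ∑ l, c l * a l) = T := by ext a; rw [hT]
  rw [hT']
  have : IsProbabilityMeasure ((cgaussianVec m 1).map T) :=
    Measure.isProbabilityMeasure_map T.continuous.measurable.aemeasurable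
  refine Measure.ext_of_charFunDual ?_
  ext L
  obtain ⟨p, hp⟩ := exists_dual_complex L
  rw [charFunDual_map, charFunDual_cgaussian L p hp,
    charFunDual_cgaussianVec _ (fun l => p * c l)]
  · simp only [norm_mul, mul_pow, ← Finset.mul_sum, hc, mul_one]
  · intro a
    rw [ContinuousLinearMap.comp_apply, hT, hp, Finset.mul_sum]
    simp only [mul_assoc]

/-- Joint rotation invariance of a pair of independent standard complex Gaussian vectors. -/
lemma map_rotation_cgaussianVec (m : ℕ) (θ : ℝ) :
    ((cgaussianVec m 1).prod (cgaussianVec m 1)).map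
      (ContinuousLinearMap.rotation (E := Fin m → ℂ) θ) =
    (cgaussianVec m 1).prod (cgaussianVec m 1) := by
  have : IsProbabilityMeasure (((cgaussianVec m 1).prod (cgaussianVec m 1)).map
      (ContinuousLinearMap.rotation (E := Fin m → ℂ) θ)) :=
    Measure.isProbabilityMeasure_map
      (ContinuousLinearMap.rotation (E := Fin m → ℂ) θ).continuous.measurable.aemeasurable
  refine Measure.ext_of_charFunDual ?_
  ext L
  obtain ⟨p, hp⟩ := exists_dual_pi (L.comp (ContinuousLinearMap.inl ℝ _ _))
  obtain ⟨q, hq⟩ := exists_dual_pi (L.comp (ContinuousLinearMap.inr ℝ _ _))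
  rw [charFunDual_map, charFunDual_prod, charFunDual_prod,
    charFunDual_cgaussianVec _ p hp, charFunDual_cgaussianVec _ q hq,
    charFunDual_cgaussianVec _ (fun l => Real.cos θ * p l - Real.sin θ * q l),
    charFunDual_cgaussianVec _ (fun l => Real.sin θ * p l + Real.cos θ * q l),
    ← Complex.exp_add, ← Complex.exp_add]
  · congr 1
    norm_cast
    rw [← neg_add, ← neg_add, neg_inj, ← add_div, ← add_div, ← Finset.sum_add_distrib,
      ← Finset.sum_add_distrib]
    congr 1
    refine Finset.sum_congr rfl fun l _ => ?_
    simp only [← Complex.normSq_eq_norm_sq, Complex.normSq_apply]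
    simp only [Complex.sub_re, Complex.sub_im, Complex.add_re, Complex.add_im,
      Complex.re_ofReal_mul, Complex.im_ofReal_mul]
    have := Real.sin_sq_add_cos_sq θ
    linear_combination ((p l).re ^ 2 + (p l).im ^ 2 + (q l).re ^ 2 + (q l).im ^ 2) * this
  · intro a
    have h1 : (ContinuousLinearMap.rotation (E := Fin m → ℂ) θ)
        ((ContinuousLinearMap.inr ℝ (Fin m → ℂ) (Fin m → ℂ)) a) =
        Real.sin θ • (ContinuousLinearMap.inl ℝ (Fin m → ℂ) (Fin m → ℂ)) a +
        Real.cos θ • (ContinuousLinearMap.inr ℝ (Fin m → ℂ) (Fin m → ℂ)) a := by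
      simp [ContinuousLinearMap.rotation_apply]
    simp only [ContinuousLinearMap.comp_apply] at hp hq ⊢
    rw [h1, map_add, map_smul, map_smul, hp, hq]
    simp only [add_mul, Finset.sum_add_distrib, mul_assoc, ← Finset.mul_sum, Complex.add_re,
      Complex.re_ofReal_mul, smul_eq_mul]
  · intro a
    have h1 : (ContinuousLinearMap.rotation (E := Fin m → ℂ) θ)
        ((ContinuousLinearMap.inl ℝ (Fin m → ℂ) (Fin m → ℂ)) a) =
        Real.cos θ • (ContinuousLinearMap.inl ℝ (Fin m → ℂ) (Fin m → ℂ)) a -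
        Real.sin θ • (ContinuousLinearMap.inr ℝ (Fin m → ℂ) (Fin m → ℂ)) a := by
      simp [ContinuousLinearMap.rotation_apply]
    simp only [ContinuousLinearMap.comp_apply] at hp hq ⊢
    rw [h1, map_sub, map_smul, map_smul, hp, hq]
    simp only [sub_mul, Finset.sum_sub_distrib, mul_assoc, ← Finset.mul_sum, Complex.sub_re,
      Complex.re_ofReal_mul, smul_eq_mul]

/-- Resampling a standard complex Gaussian vector along a unit direction preserves its law. -/
lemma map_resample_cgaussianVec {m : ℕ} (e : Fin m → ℂ) (he : ∑ l, ‖e l‖ ^ 2 = 1) :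
    ((cgaussianVec m 1).prod (cgaussian 1)).map
      (fun q : (Fin m → ℂ) × ℂ => fun l =>
        q.1 l + (q.2 - ∑ j, (starRingEnd ℂ) (e j) * q.1 j) * e l) =
    cgaussianVec m 1 := by
  set f : (Fin m → ℂ) × ℂ → Fin m → ℂ := fun q l =>
        q.1 l + (q.2 - ∑ j, (starRingEnd ℂ) (e j) * q.1 j) * e l with hf
  let T : (Fin m → ℂ) × ℂ →L[ℝ] (Fin m → ℂ) :=
    { toFun := f
      map_add' := by
        intro x y; ext l; simp [hf, mul_add, Finset.sum_add_distrib]; ring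
      map_smul' := by
        intro r x; ext l
        simp only [hf, Prod.smul_fst, Prod.smul_snd, Pi.smul_apply, mul_smul_comm,
          ← Finset.smul_sum, ← smul_sub, smul_mul_assoc, ← smul_add, RingHom.id_apply]
      cont := by fun_prop }
  have hfT : f = T := rfl
  rw [hfT]
  have : IsProbabilityMeasure (((cgaussianVec m 1).prod (cgaussian 1)).map T) :=
    Measure.isProbabilityMeasure_map T.continuous.measurable.aemeasurable
  refine Measure.ext_of_charFunDual ?_
  ext L
  obtain ⟨p, hp⟩ := exists_dual_pi L
  set c := ∑ l, p l * e l with hc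
  rw [charFunDual_map, charFunDual_prod, charFunDual_cgaussianVec _ p hp,
    charFunDual_cgaussianVec _ (fun l => p l - c * (starRingEnd ℂ) (e l)),
    charFunDual_cgaussian _ c, ← Complex.exp_add]
  · congr 1
    norm_cast
    rw [← neg_add, neg_inj, ← add_div]
    congr 1
    have h1 : ∀ l, ‖p l - c * (starRingEnd ℂ) (e l)‖ ^ 2 =
        ‖p l‖ ^ 2 + ‖c‖ ^ 2 * ‖e l‖ ^ 2 - 2 * ((starRingEnd ℂ) c * (p l * e l)).re := by
      intro l
      simp only [← Complex.normSq_eq_norm_sq, Complex.normSq_apply]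
      simp
      ring
    simp_rw [h1]
    rw [Finset.sum_sub_distrib, Finset.sum_add_distrib, ← Finset.mul_sum, he, ← Finset.mul_sum,
      ← Complex.re_sum, ← Finset.mul_sum, ← hc, ← Complex.normSq_eq_conj_mul_self,
      Complex.ofReal_re, Complex.normSq_eq_norm_sq]
    ring
  · intro z
    simp only [ContinuousLinearMap.comp_apply]
    rw [hp]
    congr 1
    simp only [← hfT, hf, ContinuousLinearMap.inr_apply, Pi.zero_apply, mul_zero,
      Finset.sum_const_zero, sub_zero, zero_add]
    rw [hc, Finset.sum_mul]
    exact Finset.sum_congr rfl fun l _ => by ring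
  · intro a
    simp only [ContinuousLinearMap.comp_apply]
    rw [hp]
    congr 1
    simp only [← hfT, hf, ContinuousLinearMap.inl_apply, zero_sub]
    rw [← sub_eq_zero, ← Finset.sum_sub_distrib]
    have h1 : ∀ l, p l * (a l + -(∑ j, (starRingEnd ℂ) (e j) * a j) * e l) -
        (p l - c * (starRingEnd ℂ) (e l)) * a l =
        c * ((starRingEnd ℂ) (e l) * a l) -
          (p l * e l) * (∑ j, (starRingEnd ℂ) (e j) * a j) := fun l => by ring
    simp_rw [h1]
    rw [Finset.sum_sub_distrib, ← Finset.mul_sum, ← Finset.sum_mul, ← hc, sub_self]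

lemma lintegral_exp_sq_gaussianReal :
    ∫⁻ x, ENNReal.ofReal (Real.exp (x ^ 2 / 2)) ∂(gaussianReal 0 (1 / 2 : ℝ).toNNReal) =
      ENNReal.ofReal (Real.sqrt 2) := by
  have hv : (1 / 2 : ℝ).toNNReal ≠ 0 := by simp
  have hc : (((1 / 2 : ℝ).toNNReal : ℝ≥0) : ℝ) = 1 / 2 := Real.coe_toNNReal _ (by norm_num)
  rw [gaussianReal, if_neg hv, lintegral_withDensity_eq_lintegral_mul _
    (measurable_gaussianPDF _ _) (by fun_prop)]
  have h1 : ∀ x : ℝ, (gaussianPDF 0 (1 / 2 : ℝ).toNNReal *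
      fun x => ENNReal.ofReal (Real.exp (x ^ 2 / 2))) x =
      ENNReal.ofReal (Real.sqrt 2) * gaussianPDF 0 1 x := by
    intro x
    simp only [Pi.mul_apply, gaussianPDF]
    rw [← ENNReal.ofReal_mul (gaussianPDFReal_nonneg _ _ _), ← ENNReal.ofReal_mul (by positivity)]
    congr 1
    simp only [gaussianPDFReal, hc, NNReal.coe_one]
    rw [mul_assoc, ← Real.exp_add, ← mul_assoc]
    congr 1
    · rw [show 2 * Real.pi * (1 / 2) = Real.pi by ring, mul_one, Real.sqrt_mul (by norm_num)]
      field_simp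
    · congr 1; ring
  simp_rw [h1]
  rw [lintegral_const_mul _ (measurable_gaussianPDF _ _),
    lintegral_gaussianPDF_eq_one _ one_ne_zero, mul_one]

lemma lintegral_exp_sq_cgaussian :
    ∫⁻ z, ENNReal.ofReal (Real.exp (‖z‖ ^ 2 / 2)) ∂(cgaussian 1) = 2 := by
  rw [cgaussian, lintegral_map (by fun_prop) measurable_cgaussian_map]
  have h1 : ∀ q : ℝ × ℝ, ENNReal.ofReal (Real.exp (‖(q.1 : ℂ) + (q.2 : ℂ) * I‖ ^ 2 / 2)) =
      ENNReal.ofReal (Real.exp (q.1 ^ 2 / 2)) * ENNReal.ofReal (Real.exp (q.2 ^ 2 / 2)) := by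
    intro q
    rw [← ENNReal.ofReal_mul (Real.exp_nonneg _), ← Real.exp_add,
      ← Complex.normSq_eq_norm_sq, Complex.normSq_apply]
    congr 2
    simp
    ring
  simp_rw [h1]
  rw [lintegral_prod_mul (f := fun x : ℝ => ENNReal.ofReal (Real.exp (x ^ 2 / 2)))
    (g := fun x : ℝ => ENNReal.ofReal (Real.exp (x ^ 2 / 2)))
    (by fun_prop) (by fun_prop), lintegral_exp_sq_gaussianReal, ← ENNReal.ofReal_mul (by positivity)]
  simp

/-- Square-exponential moment of a linear form of a standard complex Gaussian vector. -/
lemma lintegral_exp_sq_linearForm {m : ℕ} (c : Fin m → ℂ) {s : ℝ}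
    (hc : ∑ l, ‖c l‖ ^ 2 ≤ s) :
    ∫⁻ a, ENNReal.ofReal (Real.exp (‖∑ l, c l * a l‖ ^ 2 / (2 * s))) ∂(cgaussianVec m 1) ≤ 2 := by
  set q := ∑ l, ‖c l‖ ^ 2 with hq
  have hq0 : 0 ≤ q := by positivity
  rcases hq0.eq_or_lt with h0 | h0
  · have hz : ∀ l, c l = 0 := by
      intro l
      have := (Finset.sum_eq_zero_iff_of_nonneg (fun l _ => by positivity)).1 h0.symm l
        (Finset.mem_univ l)
      simpa using this
    simp [hz]
  · have hr : 0 < Real.sqrt q := Real.sqrt_pos.2 h0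
    have hu : ∑ l, ‖c l / (Real.sqrt q : ℂ)‖ ^ 2 = 1 := by
      simp only [norm_div, Complex.norm_real, Real.norm_eq_abs, abs_of_pos hr, div_pow,
        Real.sq_sqrt hq0]
      rw [← Finset.sum_div, ← hq, div_self h0.ne']
    calc _ ≤ ∫⁻ a, ENNReal.ofReal (Real.exp (‖∑ l, c l / (Real.sqrt q : ℂ) * a l‖ ^ 2 / 2))
          ∂(cgaussianVec m 1) := by
          refine lintegral_mono fun a => ENNReal.ofReal_le_ofReal (Real.exp_le_exp.2 ?_)
          have : ∑ l, c l / (Real.sqrt q : ℂ) * a l = (∑ l, c l * a l) / (Real.sqrt q : ℂ) := by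
            rw [Finset.sum_div]; exact Finset.sum_congr rfl fun l _ => by ring
          rw [this, norm_div, Complex.norm_real, Real.norm_eq_abs, abs_of_pos hr, div_pow,
            Real.sq_sqrt hq0, div_div]
          exact div_le_div_of_nonneg_left (by positivity) (by positivity) (by linarith)
      _ = ∫⁻ z, ENNReal.ofReal (Real.exp (‖z‖ ^ 2 / 2)) ∂(cgaussian 1) := by
          rw [← map_linearForm_cgaussianVec _ hu, lintegral_map (by fun_prop) (by fun_prop)]
      _ = 2 := lintegral_exp_sq_cgaussian
      _ ≤ 2 := le_rfl

/-- Truncated second moment of a linear form of a standard complex Gaussian vector. -/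
lemma lintegral_trunc_sq_linearForm {m : ℕ} (c : Fin m → ℂ) {s θ : ℝ} (hs : 0 < s)
    (hθ : 0 ≤ θ) (hc : ∑ l, ‖c l‖ ^ 2 ≤ s) :
    ∫⁻ a, ENNReal.ofReal (max (‖∑ l, c l * a l‖ - θ) 0 ^ 2) ∂(cgaussianVec m 1) ≤
      ENNReal.ofReal (4 * s * Real.exp (-θ ^ 2 / (2 * s))) := by
  have hpt : ∀ x : ℝ, 0 ≤ x → max (x - θ) 0 ^ 2 ≤
      2 * s * Real.exp (-θ ^ 2 / (2 * s)) * Real.exp (x ^ 2 / (2 * s)) := by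
    intro x hx
    rw [mul_assoc, ← Real.exp_add]
    have h1 := Real.add_one_le_exp (-θ ^ 2 / (2 * s) + x ^ 2 / (2 * s))
    rcases le_total x θ with h | h
    · rw [max_eq_right (by linarith)]
      have := Real.exp_nonneg (-θ ^ 2 / (2 * s) + x ^ 2 / (2 * s))
      nlinarith
    · rw [max_eq_left (by linarith)]
      have h2 : 2 * s * (-θ ^ 2 / (2 * s) + x ^ 2 / (2 * s)) = x ^ 2 - θ ^ 2 := by
        field_simp; ring
      nlinarith
  calc _ ≤ ∫⁻ a, ENNReal.ofReal (2 * s * Real.exp (-θ ^ 2 / (2 * s))) *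
        ENNReal.ofReal (Real.exp (‖∑ l, c l * a l‖ ^ 2 / (2 * s))) ∂(cgaussianVec m 1) := by
        refine lintegral_mono fun a => ?_
        rw [← ENNReal.ofReal_mul (by positivity)]
        exact ENNReal.ofReal_le_ofReal (hpt _ (norm_nonneg _))
    _ ≤ ENNReal.ofReal (2 * s * Real.exp (-θ ^ 2 / (2 * s))) * 2 := by
        rw [lintegral_const_mul _ (by fun_prop)]
        gcongr
        exact lintegral_exp_sq_linearForm c hc
    _ = _ := by
        rw [show (2 : ℝ≥0∞) = ENNReal.ofReal 2 by simp, ← ENNReal.ofReal_mul (by positivity)]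
        congr 1; ring

lemma lintegral_exp_norm_sq {m : ℕ} :
    ∫⁻ a, ENNReal.ofReal (Real.exp ((∑ l, ‖a l‖ ^ 2) / 2)) ∂(cgaussianVec m 1) = 2 ^ m := by
  have h1 : ∀ a : Fin m → ℂ, ENNReal.ofReal (Real.exp ((∑ l, ‖a l‖ ^ 2) / 2)) =
      ∏ l, ENNReal.ofReal (Real.exp (‖a l‖ ^ 2 / 2)) := by
    intro a
    rw [Finset.sum_div, Real.exp_sum, ENNReal.ofReal_prod_of_nonneg]
    exact fun i _ => Real.exp_nonneg _
  simp_rw [h1]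
  have hind : iIndepFun (fun (l : Fin m) (a : Fin m → ℂ) =>
      ENNReal.ofReal (Real.exp (‖a l‖ ^ 2 / 2))) (cgaussianVec m 1) :=
    iIndepFun_pi (X := fun _ (z : ℂ) => ENNReal.ofReal (Real.exp (‖z‖ ^ 2 / 2)))
      fun _ => by fun_prop
  rw [lintegral_prod_eq_prod_lintegral_of_indepFun _ _ hind fun _ => by fun_prop]
  have h2 : ∀ l : Fin m, ∫⁻ a, ENNReal.ofReal (Real.exp (‖a l‖ ^ 2 / 2)) ∂(cgaussianVec m 1) =
      2 := by
    intro l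
    rw [← lintegral_exp_sq_cgaussian]
    exact (measurePreserving_eval (fun _ : Fin m => cgaussian 1) l).lintegral_comp
      (f := fun z => ENNReal.ofReal (Real.exp (‖z‖ ^ 2 / 2))) (by fun_prop)
  simp [h2]

/-- The Euclidean norm of a standard complex Gaussian vector is rarely above `2 √m`. -/
lemma cgaussianVec_norm_sq_tail {m : ℕ} (hm : 0 < m) :
    cgaussianVec m 1 {a | 4 * (m : ℝ) ≤ ∑ l, ‖a l‖ ^ 2} ≤ ENNReal.ofReal (1 / m) := by
  have h1 := mul_meas_ge_le_lintegral (μ := cgaussianVec m 1)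
    (f := fun a : Fin m → ℂ => ENNReal.ofReal (Real.exp ((∑ l, ‖a l‖ ^ 2) / 2))) (by fun_prop)
    (ENNReal.ofReal (Real.exp (2 * m)))
  rw [lintegral_exp_norm_sq] at h1
  have hsub : {a : Fin m → ℂ | 4 * (m : ℝ) ≤ ∑ l, ‖a l‖ ^ 2} ⊆
      {a | ENNReal.ofReal (Real.exp (2 * m)) ≤
        ENNReal.ofReal (Real.exp ((∑ l, ‖a l‖ ^ 2) / 2))} := by
    intro a ha
    refine ENNReal.ofReal_le_ofReal (Real.exp_le_exp.2 ?_)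
    have : 4 * (m : ℝ) ≤ ∑ l, ‖a l‖ ^ 2 := ha
    linarith
  refine (measure_mono hsub).trans ?_
  have hm' : (0 : ℝ) < m := by exact_mod_cast hm
  have h2 : (2 : ℝ≥0∞) ^ m ≤ ENNReal.ofReal (Real.exp (2 * m)) * ENNReal.ofReal (1 / m) := by
    rw [← ENNReal.ofReal_mul (Real.exp_nonneg _), show (2 : ℝ≥0∞) = ENNReal.ofReal 2 by simp,
      ← ENNReal.ofReal_pow (by norm_num)]
    refine ENNReal.ofReal_le_ofReal ?_
    rw [mul_one_div, le_div_iff₀ hm', two_mul, Real.exp_add]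
    refine mul_le_mul ?_ ?_ hm'.le (Real.exp_nonneg _)
    · rw [← mul_one (m : ℝ), Real.exp_nat_mul]
      exact pow_le_pow_left₀ (by norm_num) (by linarith [Real.add_one_le_exp 1]) _
    · linarith [Real.add_one_le_exp (m : ℝ)]
  have h3 := h1.trans h2
  exact (ENNReal.mul_le_mul_iff_right (by simpa using Real.exp_pos _) (by simp)).1 h3

/-- Tail of a linear form of a standard complex Gaussian vector. -/
lemma cgaussianVec_linearForm_tail {m : ℕ} (c : Fin m → ℂ) {s : ℝ} (hs : 0 < s)
    (hc : ∑ l, ‖c l‖ ^ 2 ≤ s) (t : ℝ) :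
    cgaussianVec m 1 {a | t ≤ ‖∑ l, c l * a l‖ ^ 2} ≤
      ENNReal.ofReal (2 * Real.exp (-(t / (2 * s)))) := by
  have h1 := (mul_meas_ge_le_lintegral (μ := cgaussianVec m 1)
    (f := fun a : Fin m → ℂ => ENNReal.ofReal (Real.exp (‖∑ l, c l * a l‖ ^ 2 / (2 * s))))
    (by fun_prop) (ENNReal.ofReal (Real.exp (t / (2 * s))))).trans
    (lintegral_exp_sq_linearForm c hc)
  have hsub : {a : Fin m → ℂ | t ≤ ‖∑ l, c l * a l‖ ^ 2} ⊆
      {a | ENNReal.ofReal (Real.exp (t / (2 * s))) ≤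
        ENNReal.ofReal (Real.exp (‖∑ l, c l * a l‖ ^ 2 / (2 * s)))} := by
    intro a ha
    refine ENNReal.ofReal_le_ofReal (Real.exp_le_exp.2 ?_)
    have : t ≤ ‖∑ l, c l * a l‖ ^ 2 := ha
    gcongr
  refine (measure_mono hsub).trans ?_
  have h2 : (2 : ℝ≥0∞) ≤ ENNReal.ofReal (Real.exp (t / (2 * s))) *
      ENNReal.ofReal (2 * Real.exp (-(t / (2 * s)))) := by
    rw [← ENNReal.ofReal_mul (Real.exp_nonneg _), mul_left_comm, ← Real.exp_add]
    simp
  exact (ENNReal.mul_le_mul_iff_right (by simpa using Real.exp_pos _) (by simp)).1 (h1.trans h2)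

lemma gaussianReal_Icc_le (z r : ℝ) :
    gaussianReal 0 (1 / 2 : ℝ).toNNReal (Set.Icc (z - r) (z + r)) ≤
      ENNReal.ofReal (2 * r / Real.sqrt Real.pi) := by
  have hv : (1 / 2 : ℝ).toNNReal ≠ 0 := by simp
  have hc : (((1 / 2 : ℝ).toNNReal : ℝ≥0) : ℝ) = 1 / 2 := Real.coe_toNNReal _ (by norm_num)
  rw [gaussianReal_apply _ hv]
  calc _ ≤ ∫⁻ x in Set.Icc (z - r) (z + r), ENNReal.ofReal (Real.sqrt Real.pi)⁻¹ := by
        refine lintegral_mono fun x => ENNReal.ofReal_le_ofReal ?_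
        rw [gaussianPDFReal, hc, show 2 * Real.pi * (1 / 2) = Real.pi by ring]
        refine mul_le_of_le_one_right (by positivity) (Real.exp_le_one_iff.2 ?_)
        rw [neg_div]
        exact neg_nonpos.2 (by positivity)
    _ = _ := by
        rw [setLIntegral_const, Real.volume_Icc, ← ENNReal.ofReal_mul (by positivity)]
        congr 1; ring

/-- Small ball estimate for the standard complex Gaussian. -/
lemma cgaussian_small_ball (c z : ℂ) (hc : c ≠ 0) (τ : ℝ) (hτ : 0 ≤ τ) :
    cgaussian 1 {ζ | ‖c * ζ + z‖ ≤ τ} ≤ ENNReal.ofReal (2 * τ ^ 2 / ‖c‖ ^ 2) := by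
  have hc' : 0 < ‖c‖ := norm_pos_iff.2 hc
  set r := τ / ‖c‖ with hr
  set w := -(z / c) with hw
  have hsub : {q : ℝ × ℝ | ‖c * ((q.1 : ℂ) + (q.2 : ℂ) * I) + z‖ ≤ τ} ⊆
      Set.Icc (w.re - r) (w.re + r) ×ˢ Set.Icc (w.im - r) (w.im + r) := by
    intro q hq
    simp only [Set.mem_ofPred_eq] at hq
    have h1 : c * ((q.1 : ℂ) + (q.2 : ℂ) * I) + z = c * (((q.1 : ℂ) + (q.2 : ℂ) * I) - w) := by
      rw [hw]; field_simp; ring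
    rw [h1, norm_mul, mul_comm, ← le_div_iff₀ hc'] at hq
    have h2 := (Complex.abs_re_le_norm _).trans hq
    have h3 := (Complex.abs_im_le_norm _).trans hq
    simp only [Complex.sub_re, Complex.add_re, Complex.sub_im, Complex.add_im, Complex.ofReal_re,
      Complex.ofReal_im, Complex.re_ofReal_mul, Complex.im_ofReal_mul, Complex.I_re,
      Complex.I_im] at h2 h3
    rw [abs_le] at h2 h3
    simp only [Set.mem_prod, Set.mem_Icc]
    refine ⟨⟨?_, ?_⟩, ⟨?_, ?_⟩⟩ <;> linarith [h2.1, h2.2, h3.1, h3.2]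
  rw [cgaussian, Measure.map_apply measurable_cgaussian_map
    (measurableSet_le (by fun_prop) measurable_const)]
  refine (measure_mono hsub).trans ?_
  rw [Measure.prod_prod]
  refine (mul_le_mul' (gaussianReal_Icc_le _ _) (gaussianReal_Icc_le _ _)).trans ?_
  rw [← ENNReal.ofReal_mul (by positivity)]
  refine ENNReal.ofReal_le_ofReal ?_
  rw [div_mul_div_comm, Real.mul_self_sqrt Real.pi_pos.le, hr,
    show 2 * (τ / ‖c‖) * (2 * (τ / ‖c‖)) = 2 * τ ^ 2 / ‖c‖ ^ 2 * 2 by ring]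
  rw [div_le_iff₀ Real.pi_pos]
  gcongr
  exact Real.two_le_pi

/-- Cyclic convolution on `Fin m → ℂ`. -/
def cconv {m : ℕ} (a u : Fin m → ℂ) (k : Fin m) : ℂ := ∑ i, a (k - i) * u i

lemma sum_pad {n m : ℕ} (h : n ≤ m) (w : Fin n → ℂ) {M : Type*} [AddCommMonoid M]
    (f : Fin m → ℂ → M) (hf : ∀ i, f i 0 = 0) :
    ∑ i, f i (pad m w i) = ∑ j, f (Fin.castLE h j) (w j) := by
  have h1 : ∀ j, f (Fin.castLE h j) (w j) = f (Fin.castLE h j) (pad m w (Fin.castLE h j)) := by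
    intro j; simp [pad]
  simp_rw [h1]
  rw [← Finset.sum_image (s := Finset.univ) (g := Fin.castLE h) (f := fun i => f i (pad m w i))
    (fun a _ b _ hab => Fin.castLE_injective h hab)]
  symm
  refine Finset.sum_subset (Finset.subset_univ _) fun i _ hi => ?_
  have : ¬ (i : ℕ) < n := by
    intro hlt
    exact hi (Finset.mem_image.2 ⟨⟨i, hlt⟩, Finset.mem_univ _, rfl⟩)
  simp [pad, this, hf]

lemma Amat_mulVec {n m : ℕ} (h : n ≤ m) (a : Fin m → ℂ) (w : Fin n → ℂ) (k : Fin m) :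
    (Amat h a).mulVec w k = cconv a (pad m w) k := by
  rw [cconv, sum_pad h w (fun i z => a (k - i) * z) (by simp)]
  rfl

lemma cconv_comm {m : ℕ} (a u : Fin m → ℂ) (k : Fin m) :
    cconv a u k = ∑ l, u (k - l) * a l := by
  have : NeZero m := ⟨by rintro rfl; exact k.elim0⟩
  rw [cconv, ← (Equiv.subLeft k).sum_comp]
  simp [mul_comm]

lemma cconv_add_right {m : ℕ} (a u v : Fin m → ℂ) : cconv a (u + v) = cconv a u + cconv a v := by
  ext k; simp [cconv, mul_add, Finset.sum_add_distrib]

lemma pad_sub {n m : ℕ} (v w : Fin n → ℂ) : pad m (v - w) = pad m v - pad m w := by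
  ext i; by_cases hi : (i : ℕ) < n <;> simp [pad, hi]

lemma sum_norm_sq_pad {n m : ℕ} (h : n ≤ m) (w : Fin n → ℂ) :
    ∑ i, ‖pad m w i‖ ^ 2 = ∑ j, ‖w j‖ ^ 2 :=
  sum_pad h w (fun _ z => ‖z‖ ^ 2) (by simp)

lemma sum_norm_sq_shift {m : ℕ} (u : Fin m → ℂ) (k : Fin m) :
    ∑ l, ‖u (k - l)‖ ^ 2 = ∑ l, ‖u l‖ ^ 2 := by
  have : NeZero m := ⟨by rintro rfl; exact k.elim0⟩
  exact (Equiv.subLeft k).sum_comp fun l => ‖u l‖ ^ 2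

lemma cnorm_eq_norm {k : ℕ} (v : Fin k → ℂ) : cnorm v = ‖WithLp.toLp 2 v‖ := by
  rw [cnorm, EuclideanSpace.norm_eq]

lemma rnorm_eq_norm {k : ℕ} (v : Fin k → ℝ) : rnorm v = ‖WithLp.toLp 2 v‖ := by
  rw [rnorm, EuclideanSpace.norm_eq]; simp

lemma cnorm_nonneg {k : ℕ} (v : Fin k → ℂ) : 0 ≤ cnorm v := Real.sqrt_nonneg _

lemma cnorm_sq {k : ℕ} (v : Fin k → ℂ) : cnorm v ^ 2 = ∑ i, ‖v i‖ ^ 2 :=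
  Real.sq_sqrt (by positivity)

lemma rnorm_nonneg {k : ℕ} (v : Fin k → ℝ) : 0 ≤ rnorm v := Real.sqrt_nonneg _

lemma rnorm_sq {k : ℕ} (v : Fin k → ℝ) : rnorm v ^ 2 = ∑ i, v i ^ 2 :=
  Real.sq_sqrt (by positivity)

lemma cnorm_smul {k : ℕ} (c : ℂ) (v : Fin k → ℂ) : cnorm (c • v) = ‖c‖ * cnorm v := by
  rw [cnorm_eq_norm, cnorm_eq_norm, WithLp.toLp_smul, norm_smul]

lemma cnorm_sub_le {k : ℕ} (v w : Fin k → ℂ) : cnorm (v - w) ≤ cnorm v + cnorm w := by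
  simp only [cnorm_eq_norm, WithLp.toLp_sub]; exact norm_sub_le _ _

lemma rnorm_add_le {k : ℕ} (v w : Fin k → ℝ) : rnorm (v + w) ≤ rnorm v + rnorm w := by
  simp only [rnorm_eq_norm, WithLp.toLp_add]; exact norm_add_le _ _

lemma rnorm_mono {k : ℕ} {v w : Fin k → ℝ} (h0 : ∀ i, 0 ≤ v i) (h : ∀ i, v i ≤ w i) :
    rnorm v ≤ rnorm w :=
  Real.sqrt_le_sqrt (Finset.sum_le_sum fun i _ => pow_le_pow_left₀ (h0 i) (h i) 2)

lemma rnorm_const_mul {k : ℕ} {c : ℝ} (hc : 0 ≤ c) (v : Fin k → ℝ) :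
    rnorm (fun i => c * v i) = c * rnorm v := by
  simp only [rnorm, mul_pow, ← Finset.mul_sum]
  rw [Real.sqrt_mul (by positivity), Real.sqrt_sq hc]

lemma norm_le_cnorm {k : ℕ} (v : Fin k → ℂ) (i : Fin k) : ‖v i‖ ≤ cnorm v :=
  Real.le_sqrt_of_sq_le
    (Finset.single_le_sum (f := fun i => ‖v i‖ ^ 2) (fun i _ => by positivity) (Finset.mem_univ i))

/-! ### Fourier bounds for cyclic convolutions -/

/-- The Fourier transform on `Fin m`, indexed by the characters. -/
def fhat {m : ℕ} [NeZero m] (ψ : AddChar (Fin m) ℂ) (u : Fin m → ℂ) : ℂ := ∑ l, u l * ψ l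

lemma fhat_cconv {m : ℕ} [NeZero m] (ψ : AddChar (Fin m) ℂ) (a u : Fin m → ℂ) :
    fhat ψ (cconv a u) = fhat ψ a * fhat ψ u := by
  simp only [fhat, cconv]
  rw [Finset.sum_mul_sum]
  simp_rw [Finset.sum_mul]
  rw [Finset.sum_comm, Finset.sum_comm (f := fun l i => a l * ψ l * (u i * ψ i))]
  refine Finset.sum_congr rfl fun i _ => ?_
  rw [← Equiv.sum_comp (Equiv.addRight i)]
  refine Finset.sum_congr rfl fun l _ => ?_
  simp [AddChar.map_add_eq_mul]
  ring

lemma fhat_sub {m : ℕ} [NeZero m] (ψ : AddChar (Fin m) ℂ) (u v : Fin m → ℂ) :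
    fhat ψ (u - v) = fhat ψ u - fhat ψ v := by
  simp [fhat, sub_mul, Finset.sum_sub_distrib]

/-- Parseval's identity. -/
lemma sum_norm_sq_fhat {m : ℕ} [NeZero m] (u : Fin m → ℂ) :
    ∑ ψ, ‖fhat ψ u‖ ^ 2 = m * ∑ l, ‖u l‖ ^ 2 := by
  have h1 : ∀ ψ : AddChar (Fin m) ℂ, ((‖fhat ψ u‖ ^ 2 : ℝ) : ℂ) =
      ∑ k, ∑ l, u k * (starRingEnd ℂ) (u l) * ψ (k - l) := by
    intro ψ
    rw [← Complex.normSq_eq_norm_sq, ← Complex.mul_conj, fhat, map_sum, Finset.sum_mul_sum]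
    refine Finset.sum_congr rfl fun k _ => Finset.sum_congr rfl fun l _ => ?_
    rw [map_mul, sub_eq_add_neg, AddChar.map_add_eq_mul, AddChar.map_neg_eq_conj]
    ring
  have h2 : ((∑ ψ, ‖fhat ψ u‖ ^ 2 : ℝ) : ℂ) = ((m * ∑ l, ‖u l‖ ^ 2 : ℝ) : ℂ) := by
    rw [Complex.ofReal_sum]
    simp_rw [h1]
    rw [Finset.sum_comm]
    have h3 : ∀ k, ∑ ψ : AddChar (Fin m) ℂ, ∑ l, u k * (starRingEnd ℂ) (u l) * ψ (k - l) =
        m * (‖u k‖ ^ 2 : ℝ) := by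
      intro k
      rw [Finset.sum_comm]
      simp_rw [← Finset.mul_sum, AddChar.sum_apply_eq_ite, sub_eq_zero]
      simp [Complex.mul_conj, Complex.normSq_eq_norm_sq]
      ring
    simp_rw [h3]
    push_cast
    rw [Finset.mul_sum]
  exact_mod_cast h2

lemma cnorm_cconv_le {m : ℕ} [NeZero m] {U : ℝ} (hU : 0 ≤ U) (u : Fin m → ℂ)
    (hu : ∀ ψ, ‖fhat ψ u‖ ≤ U) (a : Fin m → ℂ) : cnorm (cconv a u) ≤ U * cnorm a := by
  have hm : (0 : ℝ) < m := by exact_mod_cast NeZero.pos m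
  refine Real.sqrt_le_iff.2 ⟨mul_nonneg hU (cnorm_nonneg _), ?_⟩
  rw [mul_pow, cnorm_sq]
  refine le_of_mul_le_mul_left ?_ hm
  rw [← sum_norm_sq_fhat, mul_left_comm, ← sum_norm_sq_fhat, Finset.mul_sum]
  refine Finset.sum_le_sum fun ψ _ => ?_
  rw [fhat_cconv, norm_mul, mul_pow, mul_comm]
  gcongr
  exact hu ψ

lemma norm_fhat_pad_le_sum {n m : ℕ} [NeZero m] (h : n ≤ m) (ψ : AddChar (Fin m) ℂ)
    (w : Fin n → ℂ) : ‖fhat ψ (pad m w)‖ ≤ ∑ j, ‖w j‖ := by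
  rw [fhat, sum_pad h w (fun i z => z * ψ i) (by simp)]
  refine (norm_sum_le _ _).trans (Finset.sum_le_sum fun j _ => ?_)
  simp

lemma sum_norm_le_sqrt {n : ℕ} (w : Fin n → ℂ) : ∑ j, ‖w j‖ ≤ Real.sqrt n * cnorm w := by
  rw [cnorm, ← Real.sqrt_mul (by positivity)]
  refine Real.le_sqrt_of_sq_le ?_
  have := sq_sum_le_card_mul_sum_sq (s := Finset.univ) (f := fun j => ‖w j‖)
  simpa using this

lemma norm_fhat_pad_le {n m : ℕ} [NeZero m] (h : n ≤ m) (ψ : AddChar (Fin m) ℂ)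
    (w : Fin n → ℂ) : ‖fhat ψ (pad m w)‖ ≤ Real.sqrt n * cnorm w :=
  (norm_fhat_pad_le_sum h ψ w).trans (sum_norm_le_sqrt w)

/-! ### The soft-thresholded Euclidean norm -/

/-- The Euclidean norm of the soft-thresholded vector `((|y_k| - θ)₊)_k`. -/
def softNorm {m : ℕ} (θ : ℝ) (y : Fin m → ℂ) : ℝ := rnorm fun k => max (‖y k‖ - θ) 0

lemma softNorm_nonneg {m : ℕ} (θ : ℝ) (y : Fin m → ℂ) : 0 ≤ softNorm θ y := rnorm_nonneg _

lemma softNorm_zero_left {m : ℕ} (y : Fin m → ℂ) : softNorm 0 y = cnorm y := by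
  simp [softNorm, cnorm, rnorm]

lemma softNorm_add_le {m : ℕ} (θ θ' : ℝ) (y y' : Fin m → ℂ) :
    softNorm (θ + θ') (y + y') ≤ softNorm θ y + softNorm θ' y' := by
  refine le_trans (rnorm_mono (fun _ => le_max_right _ _) fun k => ?_) (rnorm_add_le _ _)
  simp only [Pi.add_apply]
  have := norm_add_le (y k) (y' k)
  refine max_le ?_ (add_nonneg (le_max_right _ _) (le_max_right _ _))
  have h1 := le_max_left (‖y k‖ - θ) 0
  have h2 := le_max_left (‖y' k‖ - θ') 0
  linarith

lemma softNorm_smul {m : ℕ} (θ : ℝ) (c : ℂ) (y : Fin m → ℂ) :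
    softNorm (‖c‖ * θ) (c • y) = ‖c‖ * softNorm θ y := by
  rw [softNorm, softNorm, ← rnorm_const_mul (norm_nonneg c)]
  congr 1
  ext k
  rw [Pi.smul_apply, smul_eq_mul, norm_mul, ← mul_sub, mul_max_of_nonneg _ _ (norm_nonneg c),
    mul_zero]

/-- A subgradient of `softNorm θ`. -/
def softGrad {m : ℕ} (θ : ℝ) (y : Fin m → ℂ) (k : Fin m) : ℂ :=
  ((max (‖y k‖ - θ) 0 / softNorm θ y : ℝ) : ℂ) * (starRingEnd ℂ) (y k / (‖y k‖ : ℂ))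

lemma softGrad_sq_le {m : ℕ} (θ : ℝ) (y : Fin m → ℂ) : ∑ k, ‖softGrad θ y k‖ ^ 2 ≤ 1 := by
  have h1 : ∀ k, ‖softGrad θ y k‖ ^ 2 ≤ max (‖y k‖ - θ) 0 ^ 2 / softNorm θ y ^ 2 := by
    intro k
    rw [softGrad, norm_mul, RCLike.norm_conj, norm_div, mul_pow, Complex.norm_real,
      Real.norm_eq_abs, sq_abs, div_pow]
    refine mul_le_of_le_one_right (by positivity) ?_
    simp only [Complex.norm_real, norm_norm]
    exact pow_le_one₀ (by positivity) (div_self_le_one _)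
  refine (Finset.sum_le_sum fun k _ => h1 k).trans ?_
  rw [← Finset.sum_div, softNorm, rnorm_sq]
  exact div_self_le_one _

lemma softNorm_sub_le {m : ℕ} {θ : ℝ} (hθ : 0 ≤ θ) (y y' : Fin m → ℂ) :
    softNorm θ y - softNorm θ y' ≤ (∑ k, softGrad θ y k * (y k - y' k)).re := by
  rcases (softNorm_nonneg θ y).eq_or_lt with h0 | h0
  · simp only [softGrad, ← h0]
    simp [softNorm_nonneg]
  refine le_of_mul_le_mul_left ?_ h0
  have hcs : ∑ k, max (‖y k‖ - θ) 0 * max (‖y' k‖ - θ) 0 ≤ softNorm θ y * softNorm θ y' :=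
    Real.sum_mul_le_sqrt_mul_sqrt _ _ _
  have hsq : softNorm θ y * softNorm θ y = ∑ k, max (‖y k‖ - θ) 0 ^ 2 := by
    rw [← sq, softNorm, rnorm_sq]
  have hterm : ∀ k, max (‖y k‖ - θ) 0 ^ 2 - max (‖y k‖ - θ) 0 * max (‖y' k‖ - θ) 0 ≤
      softNorm θ y * (softGrad θ y k * (y k - y' k)).re := by
    intro k
    rw [softGrad, mul_assoc, Complex.re_ofReal_mul, ← mul_assoc, mul_div_cancel₀ _ h0.ne']
    rcases le_or_gt (‖y k‖) θ with h | h
    · rw [max_eq_right (a := ‖y k‖ - θ) (by linarith)]; simp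
    · have hy : 0 < ‖y k‖ := hθ.trans_lt h
      rw [max_eq_left (a := ‖y k‖ - θ) (by linarith)]
      have h1 : ((starRingEnd ℂ) (y k / (‖y k‖ : ℂ)) * y k).re = ‖y k‖ := by
        rw [map_div₀, Complex.conj_ofReal, div_mul_eq_mul_div, ← Complex.normSq_eq_conj_mul_self,
          ← Complex.ofReal_div, Complex.ofReal_re, Complex.normSq_eq_norm_sq]
        field_simp
      have h2 : ((starRingEnd ℂ) (y k / (‖y k‖ : ℂ)) * y' k).re ≤ ‖y' k‖ := by
        refine (Complex.re_le_norm _).trans ?_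
        rw [norm_mul, RCLike.norm_conj, norm_div, Complex.norm_real, norm_norm,
          div_self hy.ne', one_mul]
      rw [mul_sub, Complex.sub_re, h1]
      have h3 := le_max_left (‖y' k‖ - θ) 0
      nlinarith
  rw [mul_sub, hsq, Complex.re_sum, Finset.mul_sum]
  refine le_trans ?_ (Finset.sum_le_sum fun k _ => hterm k)
  rw [Finset.sum_sub_distrib]
  linarith

/-- The gradient of `a ↦ softNorm θ (a ⊛ u)`. -/
def convGrad {m : ℕ} (θ : ℝ) (u a : Fin m → ℂ) (l : Fin m) : ℂ :=
  ∑ k, softGrad θ (cconv a u) k * u (k - l)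

lemma softNorm_cconv_sub_le {m : ℕ} {θ : ℝ} (hθ : 0 ≤ θ) (u a b : Fin m → ℂ) :
    softNorm θ (cconv a u) - softNorm θ (cconv b u) ≤
      (∑ l, convGrad θ u a l * (a l - b l)).re := by
  refine (softNorm_sub_le hθ _ _).trans_eq ?_
  congr 1
  have h1 : ∀ k, cconv a u k - cconv b u k = ∑ l, u (k - l) * (a l - b l) := by
    intro k
    rw [cconv_comm, cconv_comm, ← Finset.sum_sub_distrib]
    simp only [mul_sub]
  simp_rw [h1, convGrad, Finset.mul_sum, Finset.sum_mul]
  rw [Finset.sum_comm]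
  simp only [mul_assoc]

lemma convGrad_sq_le {m : ℕ} {θ L : ℝ} (u a : Fin m → ℂ) (hL0 : 0 ≤ L)
    (hL : ∀ b, cnorm (cconv b u) ≤ L * cnorm b) : ∑ l, ‖convGrad θ u a l‖ ^ 2 ≤ L ^ 2 := by
  set D := convGrad θ u a with hD
  have h1 : cnorm D ^ 2 ≤ L * cnorm D := by
    set b : Fin m → ℂ := fun l => (starRingEnd ℂ) (D l) with hb
    have hnb : cnorm b = cnorm D := by simp [cnorm, hb]
    have h2 : ((cnorm D ^ 2 : ℝ) : ℂ) = ∑ k, softGrad θ (cconv a u) k * cconv b u k := by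
      rw [cnorm_sq]
      simp_rw [cconv_comm, Finset.mul_sum]
      rw [Finset.sum_comm, Complex.ofReal_sum]
      refine Finset.sum_congr rfl fun l _ => ?_
      rw [← Complex.normSq_eq_norm_sq, ← Complex.mul_conj]
      conv_lhs => enter [1]; rw [hD, convGrad]
      rw [Finset.sum_mul]
      simp only [mul_assoc, hb]
    have h3 : cnorm D ^ 2 = ‖∑ k, softGrad θ (cconv a u) k * cconv b u k‖ := by
      rw [← h2, Complex.norm_real, Real.norm_eq_abs, abs_of_nonneg (by positivity)]
    rw [h3]
    calc _ ≤ ∑ k, ‖softGrad θ (cconv a u) k‖ * ‖cconv b u k‖ := by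
          refine (norm_sum_le _ _).trans_eq ?_
          simp
      _ ≤ Real.sqrt (∑ k, ‖softGrad θ (cconv a u) k‖ ^ 2) * cnorm (cconv b u) :=
          Real.sum_mul_le_sqrt_mul_sqrt _ _ _
      _ ≤ 1 * (L * cnorm b) := by
          gcongr
          · exact cnorm_nonneg _
          · exact Real.sqrt_le_one.2 (softGrad_sq_le _ _)
          · exact hL b
      _ = _ := by rw [one_mul, hnb]
  rw [← cnorm_sq]
  have h4 : cnorm D ≤ L := by
    by_contra hlt
    push Not at hlt
    nlinarith [cnorm_nonneg D]
  exact pow_le_pow_left₀ (cnorm_nonneg _) h4 2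

@[fun_prop]
lemma measurable_cconv {m : ℕ} (u : Fin m → ℂ) : Measurable fun a => cconv a u := by
  unfold cconv; fun_prop

@[fun_prop]
lemma measurable_softNorm {m : ℕ} (θ : ℝ) : Measurable (softNorm (m := m) θ) := by
  unfold softNorm rnorm; fun_prop

@[fun_prop]
lemma measurable_convGrad {m : ℕ} (θ : ℝ) (u : Fin m → ℂ) : Measurable (convGrad θ u) := by
  unfold convGrad softGrad
  refine measurable_pi_lambda _ fun l => ?_
  fun_prop

/-! ### The number of small coordinates -/

/-- The linear forms attached to the rows of a square array. -/
def linForm {m : ℕ} {κ : Type*} (V : κ → Fin m → ℂ) (k : κ) (a : Fin m → ℂ) : ℂ :=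
  ∑ l, V k l * a l

@[fun_prop]
lemma measurable_linForm {m : ℕ} {κ : Type*} (V : κ → Fin m → ℂ) (k : κ) :
    Measurable (linForm V k) := by
  unfold linForm; fun_prop

lemma measure_inter_small_le {m : ℕ} {ι κ : Type*} [Countable ι] (V : κ → Fin m → ℂ) (j : ι → κ)
    (k : κ) (τ : ℝ) (hτ : 0 ≤ τ) (e : Fin m → ℂ) (he : ∑ l, ‖e l‖ ^ 2 = 1)
    (horth : ∀ i, linForm V (j i) e = 0) (hk : 1 / 2 ≤ ‖linForm V k e‖ ^ 2) :
    cgaussianVec m 1 {a | ‖linForm V k a‖ ≤ τ ∧ ∀ i, ‖linForm V (j i) a‖ ≤ τ} ≤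
      ENNReal.ofReal (4 * τ ^ 2) *
        cgaussianVec m 1 {a | ∀ i, ‖linForm V (j i) a‖ ≤ τ} := by
  set c := linForm V k e with hc
  have hc0 : c ≠ 0 := by
    rintro h; rw [h] at hk; norm_num at hk
  have hE : MeasurableSet {a : Fin m → ℂ | ∀ i, ‖linForm V (j i) a‖ ≤ τ} := by
    have : {a : Fin m → ℂ | ∀ i, ‖linForm V (j i) a‖ ≤ τ} =
        ⋂ i, {a | ‖linForm V (j i) a‖ ≤ τ} := by ext; simp
    rw [this]
    exact MeasurableSet.iInter fun i => measurableSet_le (by fun_prop) measurable_const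
  have hE2 : MeasurableSet {a : Fin m → ℂ | ‖linForm V k a‖ ≤ τ ∧
      ∀ i, ‖linForm V (j i) a‖ ≤ τ} := by
    have hk' : MeasurableSet {a : Fin m → ℂ | ‖linForm V k a‖ ≤ τ} :=
      measurableSet_le (by fun_prop) measurable_const
    exact hk'.inter hE
  have hmap := map_resample_cgaussianVec e he
  have hlin : ∀ (i : κ) (a : Fin m → ℂ) (t : ℂ),
      linForm V i (fun l => a l + t * e l) = linForm V i a + t * linForm V i e := by
    intro i a t
    simp only [linForm, mul_add, Finset.sum_add_distrib, Finset.mul_sum]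
    congr 1
    exact Finset.sum_congr rfl fun l _ => by ring
  conv_lhs => rw [← hmap]
  have hmeas : Measurable (fun q : (Fin m → ℂ) × ℂ => fun l =>
        q.1 l + (q.2 - ∑ j, (starRingEnd ℂ) (e j) * q.1 j) * e l) := by fun_prop
  rw [Measure.map_apply hmeas hE2, Measure.prod_apply (hmeas hE2),
    ← lintegral_indicator_const hE]
  refine lintegral_mono fun a => ?_
  by_cases ha : a ∈ {a : Fin m → ℂ | ∀ i, ‖linForm V (j i) a‖ ≤ τ}
  · rw [Set.indicator_of_mem ha]
    set t := ∑ j, (starRingEnd ℂ) (e j) * a j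
    have hsub : (Prod.mk a ⁻¹' ((fun q : (Fin m → ℂ) × ℂ => fun l =>
        q.1 l + (q.2 - ∑ j, (starRingEnd ℂ) (e j) * q.1 j) * e l) ⁻¹'
        {a | ‖linForm V k a‖ ≤ τ ∧ ∀ i, ‖linForm V (j i) a‖ ≤ τ})) ⊆
        {ζ | ‖c * ζ + (linForm V k a - t * c)‖ ≤ τ} := by
      intro ζ hζ
      have h1 := hζ.1
      rw [hlin] at h1
      show ‖c * ζ + (linForm V k a - t * c)‖ ≤ τ
      convert h1 using 2
      ring
    refine (measure_mono hsub).trans ((cgaussian_small_ball c _ hc0 τ hτ).trans ?_)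
    refine ENNReal.ofReal_le_ofReal ?_
    rw [div_le_iff₀ (by positivity)]
    nlinarith [sq_nonneg τ]
  · rw [Set.indicator_of_notMem ha]
    refine le_of_eq ?_
    convert measure_empty (μ := cgaussian 1)
    ext ζ
    simp only [Set.mem_preimage, Set.mem_empty_iff_false, iff_false]
    intro hζ
    refine ha fun i => ?_
    have h1 := hζ.2 i
    rw [hlin, horth, mul_zero, add_zero] at h1
    exact h1

/-- Outside a small exceptional set, every row is far from the span of a given family of rows. -/
lemma exists_bad_rows {m q : ℕ} (V : Fin m → Fin m → ℂ) (N : ℝ) (hN : 0 ≤ N)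
    (hV : ∀ k, ∑ l, ‖V k l‖ ^ 2 = 1)
    (hop : ∀ e : Fin m → ℂ, ∑ l, ‖e l‖ ^ 2 = 1 → ∑ k, ‖linForm V k e‖ ^ 2 ≤ N)
    (j : Fin q → Fin m) :
    ∃ B : Finset (Fin m), (B.card : ℝ) ≤ 2 * N * q ∧ ∀ k ∉ B, ∃ e : Fin m → ℂ,
      ∑ l, ‖e l‖ ^ 2 = 1 ∧ (∀ i, linForm V (j i) e = 0) ∧ 1 / 2 ≤ ‖linForm V k e‖ ^ 2 := by
  classical
  let X : Fin m → EuclideanSpace ℂ (Fin m) := fun k =>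
    WithLp.toLp 2 fun l => (starRingEnd ℂ) (V k l)
  have hX : ∀ k (a : EuclideanSpace ℂ (Fin m)), inner ℂ (X k) a = linForm V k a := by
    intro k a
    simp [X, linForm, PiLp.inner_apply, mul_comm]
  have hXn : ∀ k, ‖X k‖ ^ 2 = 1 := by
    intro k
    rw [EuclideanSpace.norm_sq_eq, ← hV k]
    simp [X]
  let W : Submodule ℂ (EuclideanSpace ℂ (Fin m)) := Submodule.span ℂ (Set.range fun i => X (j i))
  have hdim : Module.finrank ℂ W ≤ q :=
    (finrank_range_le_card (R := ℂ) (fun i => X (j i))).trans_eq (by simp)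
  let b := stdOrthonormalBasis ℂ W
  refine ⟨Finset.univ.filter fun k => 1 / 2 ≤ ‖W.starProjection (X k)‖ ^ 2, ?_, ?_⟩
  · have h1 : ∀ k, ‖W.starProjection (X k)‖ ^ 2 = ∑ i, ‖linForm V k (b i : EuclideanSpace ℂ (Fin m))‖ ^ 2 := by
      intro k
      have h2 : ‖W.starProjection (X k)‖ = ‖W.orthogonalProjectionOnto (X k)‖ := rfl
      rw [h2, ← b.sum_sq_norm_inner_right (W.orthogonalProjectionOnto (X k))]
      refine Finset.sum_congr rfl fun i _ => ?_
      rw [← hX, Submodule.coe_inner]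
      rw [← norm_inner_symm]
      congr 2
      have := W.starProjection_inner_eq_zero (X k) (b i) (b i).2
      rw [inner_sub_left, sub_eq_zero] at this
      exact this.symm
    have h3 : ∑ k, ‖W.starProjection (X k)‖ ^ 2 ≤ N * q := by
      simp_rw [h1]
      rw [Finset.sum_comm]
      calc _ ≤ ∑ i : Fin (Module.finrank ℂ W), N := by
            refine Finset.sum_le_sum fun i _ => hop _ ?_
            have h4 : ‖(b i : EuclideanSpace ℂ (Fin m))‖ = 1 := b.orthonormal.1 i
            rw [← EuclideanSpace.norm_sq_eq, h4, one_pow]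
        _ ≤ N * q := by
            simp only [Finset.sum_const, Finset.card_univ, Fintype.card_fin, nsmul_eq_mul]
            rw [mul_comm]
            gcongr
    have h5 : ((Finset.univ.filter fun k => 1 / 2 ≤ ‖W.starProjection (X k)‖ ^ 2).card : ℝ) *
        (1 / 2) ≤ ∑ k, ‖W.starProjection (X k)‖ ^ 2 := by
      rw [← nsmul_eq_mul]
      refine (Finset.card_nsmul_le_sum _ _ _ fun k hk => (Finset.mem_filter.1 hk).2).trans ?_
      exact Finset.sum_le_sum_of_subset_of_nonneg (Finset.filter_subset _ _)
        fun _ _ _ => by positivity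
    linarith
  · intro k hk
    have hk' : ‖W.starProjection (X k)‖ ^ 2 < 1 / 2 := by
      by_contra hh
      exact hk (Finset.mem_filter.2 ⟨Finset.mem_univ _, not_lt.1 hh⟩)
    set D := X k - W.starProjection (X k) with hD
    have hDo : ∀ w ∈ W, inner ℂ D w = 0 := fun w hw => W.starProjection_inner_eq_zero (X k) w hw
    have hpyth : ‖X k‖ ^ 2 = ‖D‖ ^ 2 + ‖W.starProjection (X k)‖ ^ 2 := by
      have h0 : inner ℂ D (W.starProjection (X k)) = 0 :=
        hDo _ (W.starProjection_apply_mem (X k))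
      have := norm_add_sq_eq_norm_sq_add_norm_sq_of_inner_eq_zero D _ h0
      rw [hD, sub_add_cancel, ← hD] at this
      simpa [sq] using this
    rw [hXn] at hpyth
    have hDn : 1 / 2 ≤ ‖D‖ ^ 2 := by linarith
    have hD0 : 0 < ‖D‖ := by
      by_contra hh
      have : ‖D‖ = 0 := le_antisymm (not_lt.1 hh) (norm_nonneg _)
      rw [this] at hDn; norm_num at hDn
    refine ⟨((‖D‖ : ℂ)⁻¹ • D : EuclideanSpace ℂ (Fin m)), ?_, ?_, ?_⟩
    · rw [← EuclideanSpace.norm_sq_eq, norm_smul, norm_inv, Complex.norm_real, norm_norm,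
        inv_mul_cancel₀ hD0.ne', one_pow]
    · intro i
      rw [← hX, inner_smul_right, inner_eq_zero_symm.1 (hDo _ (Submodule.subset_span ⟨i, rfl⟩)),
        mul_zero]
    · rw [← hX, inner_smul_right]
      have h6 : inner ℂ (X k) D = (‖D‖ ^ 2 : ℂ) := by
        have : X k = D + W.starProjection (X k) := by rw [hD, sub_add_cancel]
        conv_lhs => rw [this]
        rw [inner_add_left, inner_eq_zero_symm.1 (hDo _ (W.starProjection_apply_mem (X k))),
          add_zero, inner_self_eq_norm_sq_to_K]
        rfl
      rw [h6, norm_mul, norm_inv, norm_pow, Complex.norm_real, norm_norm, sq ‖D‖,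
        inv_mul_cancel_left₀ hD0.ne']
      exact hDn

lemma sum_measure_small_tuples_le {m : ℕ} (V : Fin m → Fin m → ℂ) (N : ℝ) (hN : 0 ≤ N)
    (hV : ∀ k, ∑ l, ‖V k l‖ ^ 2 = 1)
    (hop : ∀ e : Fin m → ℂ, ∑ l, ‖e l‖ ^ 2 = 1 → ∑ k, ‖linForm V k e‖ ^ 2 ≤ N)
    (τ : ℝ) (hτ : 0 ≤ τ) (p q : ℕ) (hq : q ≤ p) :
    ∑ j : Fin q → Fin m, cgaussianVec m 1 {a | ∀ i, ‖linForm V (j i) a‖ ≤ τ} ≤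
      ENNReal.ofReal (2 * N * p + 4 * m * τ ^ 2) ^ q := by
  induction q with
  | zero => simp
  | succ q ih =>
    have ih' := ih (by omega)
    rw [← (Fin.consEquiv fun _ : Fin (q + 1) => Fin m).sum_comp, Fintype.sum_prod_type,
      Finset.sum_comm, pow_succ']
    refine le_trans ?_ (mul_le_mul_right ih' _)
    rw [Finset.mul_sum]
    refine Finset.sum_le_sum fun j _ => ?_
    have hset : ∀ k, {a : Fin m → ℂ | ∀ i,
        ‖linForm V ((Fin.consEquiv fun _ : Fin (q + 1) => Fin m) (k, j) i) a‖ ≤ τ} =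
        {a | ‖linForm V k a‖ ≤ τ ∧ ∀ i, ‖linForm V (j i) a‖ ≤ τ} := by
      intro k; ext a
      simp [Fin.consEquiv, Fin.forall_fin_succ]
    simp_rw [hset]
    obtain ⟨B, hB, hgood⟩ := exists_bad_rows V N hN hV hop j
    set P := cgaussianVec m 1 {a | ∀ i, ‖linForm V (j i) a‖ ≤ τ}
    have hle : ∀ k, cgaussianVec m 1 {a | ‖linForm V k a‖ ≤ τ ∧ ∀ i, ‖linForm V (j i) a‖ ≤ τ} ≤
        (if k ∈ B then 1 else 0) * P + ENNReal.ofReal (4 * τ ^ 2) * P := by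
      intro k
      by_cases hk : k ∈ B
      · rw [if_pos hk, one_mul]
        exact (measure_mono fun a ha => ha.2).trans le_self_add
      · obtain ⟨e, he, ho, hke⟩ := hgood k hk
        exact (measure_inter_small_le V j k τ hτ e he ho hke).trans le_add_self
    refine (Finset.sum_le_sum fun k _ => hle k).trans ?_
    rw [Finset.sum_add_distrib, ← Finset.sum_mul, ← Finset.sum_mul, ← add_mul]
    gcongr
    simp only [Finset.sum_ite_mem, Finset.univ_inter, Finset.sum_const, nsmul_eq_mul, mul_one,
      Finset.card_univ, Fintype.card_fin]
    rw [← ENNReal.ofReal_natCast, ← ENNReal.ofReal_natCast (n := m),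
      ← ENNReal.ofReal_mul (by positivity), ← ENNReal.ofReal_add (by positivity) (by positivity)]
    refine ENNReal.ofReal_le_ofReal ?_
    have h1 : 2 * N * q ≤ 2 * N * p := by gcongr; omega
    nlinarith

/-- Few rows produce a small linear form, with exponentially high probability. -/
lemma measure_card_small_le {m : ℕ} (V : Fin m → Fin m → ℂ) (N : ℝ) (hN : 0 < N)
    (hV : ∀ k, ∑ l, ‖V k l‖ ^ 2 = 1)
    (hop : ∀ e : Fin m → ℂ, ∑ l, ‖e l‖ ^ 2 = 1 → ∑ k, ‖linForm V k e‖ ^ 2 ≤ N)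
    (τ : ℝ) (hτ : 0 ≤ τ) (p : ℕ) (hp : 0 < p) :
    cgaussianVec m 1 {a | Real.exp 1 * (2 * N * p + 4 * m * τ ^ 2) ≤
        ((Finset.univ.filter fun k => ‖linForm V k a‖ ≤ τ).card : ℝ)} ≤
      ENNReal.ofReal (Real.exp (-p)) := by
  set D := 2 * N * p + 4 * m * τ ^ 2 with hD
  have hp' : (0 : ℝ) < p := by exact_mod_cast hp
  have hD0 : 0 < D := by positivity
  let Z : (Fin m → ℂ) → ℝ≥0∞ := fun a => ∑ k, if ‖linForm V k a‖ ≤ τ then 1 else 0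
  have hZm : ∀ k, MeasurableSet {a : Fin m → ℂ | ‖linForm V k a‖ ≤ τ} := fun k =>
    measurableSet_le (by fun_prop) measurable_const
  have hZ : Measurable Z :=
    Finset.measurable_sum _ fun k _ => Measurable.ite (hZm k) measurable_const measurable_const
  have hmom : ∫⁻ a, Z a ^ p ∂(cgaussianVec m 1) ≤ ENNReal.ofReal D ^ p := by
    refine le_trans (le_of_eq ?_) (sum_measure_small_tuples_le V N hN.le hV hop τ hτ p p le_rfl)
    have h1 : ∀ a, Z a ^ p = ∑ j : Fin p → Fin m,
        {a : Fin m → ℂ | ∀ i, ‖linForm V (j i) a‖ ≤ τ}.indicator 1 a := by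
      intro a
      simp only [Z]
      rw [Finset.sum_pow']
      simp only [Fintype.piFinset_univ]
      refine Finset.sum_congr rfl fun j _ => ?_
      by_cases h : ∀ i, ‖linForm V (j i) a‖ ≤ τ
      · rw [Set.indicator_of_mem (by exact h)]
        simp [h]
      · rw [Set.indicator_of_notMem (by exact h)]
        push Not at h
        obtain ⟨i, hi⟩ := h
        exact Finset.prod_eq_zero (Finset.mem_univ i) (if_neg (not_le.2 hi))
    have hEm : ∀ j : Fin p → Fin m,
        MeasurableSet {a : Fin m → ℂ | ∀ i, ‖linForm V (j i) a‖ ≤ τ} := by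
      intro j
      have : {a : Fin m → ℂ | ∀ i, ‖linForm V (j i) a‖ ≤ τ} =
          ⋂ i, {a | ‖linForm V (j i) a‖ ≤ τ} := by ext; simp
      rw [this]
      exact MeasurableSet.iInter fun i => hZm (j i)
    simp_rw [h1]
    rw [lintegral_finsetSum _ fun j _ => measurable_one.indicator (hEm j)]
    exact Finset.sum_congr rfl fun j _ => lintegral_indicator_one (hEm j)
  have hsub : {a : Fin m → ℂ | Real.exp 1 * D ≤
        ((Finset.univ.filter fun k => ‖linForm V k a‖ ≤ τ).card : ℝ)} ⊆
      {a | ENNReal.ofReal (Real.exp 1 * D) ^ p ≤ Z a ^ p} := by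
    intro a ha
    have h2 : Z a = ENNReal.ofReal ((Finset.univ.filter fun k => ‖linForm V k a‖ ≤ τ).card : ℝ) := by
      simp [Z]
    show ENNReal.ofReal (Real.exp 1 * D) ^ p ≤ Z a ^ p
    gcongr
    rw [h2]
    exact ENNReal.ofReal_le_ofReal ha
  refine (measure_mono hsub).trans ?_
  have h3 := (mul_meas_ge_le_lintegral (μ := cgaussianVec m 1) (hZ.pow_const p)
    (ENNReal.ofReal (Real.exp 1 * D) ^ p)).trans hmom
  have h4 : ENNReal.ofReal D ^ p =
      ENNReal.ofReal (Real.exp 1 * D) ^ p * ENNReal.ofReal (Real.exp (-p)) := by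
    rw [← ENNReal.ofReal_pow hD0.le, ← ENNReal.ofReal_pow (by positivity),
      ← ENNReal.ofReal_mul (by positivity), mul_pow, ← Real.exp_nat_mul, mul_one, mul_right_comm,
      ← Real.exp_add]
    simp
  rw [h4] at h3
  refine (ENNReal.mul_le_mul_iff_right ?_ (by simp)).1 h3
  exact pow_ne_zero _ (by simpa using mul_pos (Real.exp_pos 1) hD0)

/-! ### Gaussian concentration for convex Lipschitz functions -/

lemma lintegral_exp_gaussianReal (t : ℝ) :
    ∫⁻ x, ENNReal.ofReal (Real.exp (t * x)) ∂(gaussianReal 0 (1 / 2 : ℝ).toNNReal) =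
      ENNReal.ofReal (Real.exp (t ^ 2 / 4)) := by
  have h := congrFun (mgf_fun_id_gaussianReal (μ := 0) (v := (1 / 2 : ℝ).toNNReal)) t
  rw [mgf] at h
  rw [← ofReal_integral_eq_lintegral_ofReal (integrable_exp_mul_gaussianReal t)
    (ae_of_all _ fun _ => Real.exp_nonneg _), h, Real.coe_toNNReal _ (by norm_num)]
  congr 2
  ring

/-- Exponential moments of a real-linear form of a standard complex Gaussian vector. -/
lemma lintegral_exp_re_cgaussianVec {m : ℕ} (p : Fin m → ℂ) :
    ∫⁻ a, ENNReal.ofReal (Real.exp (∑ l, p l * a l).re) ∂(cgaussianVec m 1) =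
      ENNReal.ofReal (Real.exp ((∑ l, ‖p l‖ ^ 2) / 4)) := by
  have h0 : ∀ p : ℂ, ∫⁻ z, ENNReal.ofReal (Real.exp (p * z).re) ∂(cgaussian 1) =
      ENNReal.ofReal (Real.exp (‖p‖ ^ 2 / 4)) := by
    intro p
    rw [cgaussian, lintegral_map (by fun_prop) measurable_cgaussian_map]
    have h1 : ∀ q : ℝ × ℝ, ENNReal.ofReal (Real.exp (p * ((q.1 : ℂ) + (q.2 : ℂ) * I)).re) =
        ENNReal.ofReal (Real.exp (p.re * q.1)) * ENNReal.ofReal (Real.exp (-p.im * q.2)) := by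
      intro q
      rw [← ENNReal.ofReal_mul (Real.exp_nonneg _), ← Real.exp_add]
      congr 2
      simp
      ring
    simp_rw [h1]
    rw [lintegral_prod_mul (f := fun x : ℝ => ENNReal.ofReal (Real.exp (p.re * x)))
      (g := fun x : ℝ => ENNReal.ofReal (Real.exp (-p.im * x)))
      (by fun_prop) (by fun_prop), lintegral_exp_gaussianReal, lintegral_exp_gaussianReal,
      ← ENNReal.ofReal_mul (by positivity), ← Real.exp_add, ← Complex.normSq_eq_norm_sq,
      Complex.normSq_apply]
    congr 2
    ring
  have h1 : ∀ a : Fin m → ℂ, ENNReal.ofReal (Real.exp (∑ l, p l * a l).re) =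
      ∏ l, ENNReal.ofReal (Real.exp (p l * a l).re) := by
    intro a
    rw [Complex.re_sum, Real.exp_sum, ENNReal.ofReal_prod_of_nonneg]
    exact fun i _ => Real.exp_nonneg _
  simp_rw [h1]
  have hind : iIndepFun (fun (l : Fin m) (a : Fin m → ℂ) =>
      ENNReal.ofReal (Real.exp (p l * a l).re)) (cgaussianVec m 1) :=
    iIndepFun_pi (X := fun l (z : ℂ) => ENNReal.ofReal (Real.exp (p l * z).re))
      fun _ => by fun_prop
  rw [lintegral_prod_eq_prod_lintegral_of_indepFun _ _ hind fun _ => by fun_prop]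
  have h2 : ∀ l : Fin m, ∫⁻ a, ENNReal.ofReal (Real.exp (p l * a l).re) ∂(cgaussianVec m 1) =
      ENNReal.ofReal (Real.exp (‖p l‖ ^ 2 / 4)) := by
    intro l
    rw [← h0]
    exact (measurePreserving_eval (fun _ : Fin m => cgaussian 1) l).lintegral_comp
      (f := fun z => ENNReal.ofReal (Real.exp (p l * z).re)) (by fun_prop)
  simp_rw [h2]
  rw [← ENNReal.ofReal_prod_of_nonneg fun i _ => Real.exp_nonneg _, ← Real.exp_sum,
    Finset.sum_div]

@[fun_prop]
lemma measurable_cnorm {m : ℕ} : Measurable (cnorm (k := m)) := by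
  unfold cnorm; fun_prop

lemma lintegral_exp_cnorm_le_two {m : ℕ} {ε : ℝ} (h0 : 0 ≤ ε) (hε : ε ≤ (1 / 2) ^ (m + 1)) :
    ∫⁻ a, ENNReal.ofReal (Real.exp (ε * cnorm a)) ∂(cgaussianVec m 1) ≤ 2 := by
  have hε1 : ε ≤ 1 / 2 := hε.trans (by
    simpa using pow_le_pow_of_le_one (a := (1 / 2 : ℝ)) (by norm_num) (by norm_num)
      (show 1 ≤ m + 1 by omega))
  have hpt : ∀ a : Fin m → ℂ, Real.exp (ε * cnorm a) ≤
      4 / 3 + 4 / 3 * ε * Real.exp ((∑ l, ‖a l‖ ^ 2) / 2) := by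
    intro a
    rw [← cnorm_sq]
    set r := cnorm a
    have h1 : ε * r ≤ ε / 2 + ε * (r ^ 2 / 2) := by nlinarith [sq_nonneg (r - 1)]
    have h2 : Real.exp (ε / 2) ≤ 4 / 3 := by
      have := Real.exp_bound_div_one_sub_of_interval (x := ε / 2) (by positivity) (by linarith)
      refine this.trans ?_
      rw [div_le_div_iff₀ (by linarith) (by norm_num)]
      linarith
    have h3 : Real.exp (ε * (r ^ 2 / 2)) ≤ 1 + ε * Real.exp (r ^ 2 / 2) := by
      have := convexOn_exp.2 (Set.mem_univ (r ^ 2 / 2)) (Set.mem_univ 0) h0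
        (show 0 ≤ 1 - ε by linarith) (by ring)
      simp only [smul_eq_mul, mul_zero, add_zero, Real.exp_zero, mul_one] at this
      linarith
    calc Real.exp (ε * r) ≤ Real.exp (ε / 2) * Real.exp (ε * (r ^ 2 / 2)) := by
          rw [← Real.exp_add]; exact Real.exp_le_exp.2 h1
      _ ≤ 4 / 3 * (1 + ε * Real.exp (r ^ 2 / 2)) := by gcongr
      _ = _ := by ring
  calc _ ≤ ∫⁻ a, (ENNReal.ofReal (4 / 3) + ENNReal.ofReal (4 / 3 * ε) *
        ENNReal.ofReal (Real.exp ((∑ l, ‖a l‖ ^ 2) / 2))) ∂(cgaussianVec m 1) := by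
        refine lintegral_mono fun a => ?_
        rw [← ENNReal.ofReal_mul (by positivity), ← ENNReal.ofReal_add (by norm_num)
          (by positivity)]
        exact ENNReal.ofReal_le_ofReal (hpt a)
    _ = ENNReal.ofReal (4 / 3) + ENNReal.ofReal (4 / 3 * ε) * 2 ^ m := by
        rw [lintegral_add_left measurable_const, lintegral_const, measure_univ, mul_one,
          lintegral_const_mul _ (by fun_prop), lintegral_exp_norm_sq]
    _ ≤ 2 := by
        rw [show (2 : ℝ≥0∞) = ENNReal.ofReal 2 by simp, ← ENNReal.ofReal_pow (by norm_num),
          ← ENNReal.ofReal_mul (by positivity), ← ENNReal.ofReal_add (by norm_num)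
          (by positivity)]
        refine ENNReal.ofReal_le_ofReal ?_
        have : ε * 2 ^ m ≤ 1 / 2 := by
          calc ε * 2 ^ m ≤ (1 / 2) ^ (m + 1) * 2 ^ m := by gcongr
            _ = 1 / 2 := by
              rw [pow_succ, mul_right_comm, ← mul_pow]; norm_num
        linarith

lemma re_sum_mul_le {m : ℕ} {L : ℝ} (hL : 0 ≤ L) (D X : Fin m → ℂ)
    (hD : ∑ l, ‖D l‖ ^ 2 ≤ L ^ 2) : (∑ l, D l * X l).re ≤ L * cnorm X := by
  calc (∑ l, D l * X l).re ≤ ‖∑ l, D l * X l‖ := Complex.re_le_norm _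
    _ ≤ ∑ l, ‖D l‖ * ‖X l‖ := (norm_sum_le _ _).trans_eq (by simp)
    _ ≤ Real.sqrt (∑ l, ‖D l‖ ^ 2) * cnorm X := Real.sum_mul_le_sqrt_mul_sqrt _ _ _
    _ ≤ L * cnorm X := by
        gcongr
        · exact cnorm_nonneg _
        · exact Real.sqrt_le_iff.2 ⟨hL, hD⟩

lemma lintegral_exp_diff_le {m : ℕ} (F : (Fin m → ℂ) → ℝ)
    (D : (Fin m → ℂ) → Fin m → ℂ) (hDm : Measurable D) {L t : ℝ} (hL : 0 ≤ L) (ht : 0 ≤ t)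
    (hD : ∀ a, ∑ l, ‖D a l‖ ^ 2 ≤ L ^ 2)
    (hF : ∀ a b, F a - F b ≤ (∑ l, D a l * (a l - b l)).re) :
    ∫⁻ q, ENNReal.ofReal (Real.exp (t * (F q.1 - F q.2)))
        ∂((cgaussianVec m 1).prod (cgaussianVec m 1)) ≤
      ENNReal.ofReal (2 * Real.exp (t ^ 2 * L ^ 2)) := by
  obtain ⟨N, hN⟩ := exists_nat_gt (t * L * 2 / (1 / 2) ^ (m + 1))
  have hN0 : (0 : ℝ) < N := lt_of_le_of_lt (by positivity) hN
  rw [div_lt_iff₀ (by positivity)] at hN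
  set h := Real.pi / (2 * N) with hh
  have hh0 : 0 ≤ h := by have := Real.pi_pos; positivity
  have hNh : N * h = Real.pi / 2 := by rw [hh]; field_simp
  set α := t * N * (1 - Real.cos h) * L with hα
  have hcos : 0 ≤ 1 - Real.cos h := by linarith [Real.cos_le_one h]
  have hα0 : 0 ≤ α := by positivity
  have hα1 : α ≤ (1 / 2) ^ (m + 1) := by
    have h1 := Real.one_sub_sq_div_two_le_cos (x := h)
    have h2 : N * (1 - Real.cos h) * N ≤ 2 := by
      calc N * (1 - Real.cos h) * N ≤ N * (h ^ 2 / 2) * N := by gcongr; linarith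
        _ = (N * h) ^ 2 / 2 := by ring
        _ = (Real.pi / 2) ^ 2 / 2 := by rw [hNh]
        _ ≤ 2 := by nlinarith [Real.pi_pos, Real.pi_le_four]
    refine le_of_mul_le_mul_right ?_ hN0
    calc α * N = t * L * (N * (1 - Real.cos h) * N) := by rw [hα]; ring
      _ ≤ t * L * 2 := by gcongr
      _ ≤ (1 / 2) ^ (m + 1) * N := by linarith
  set p : (Fin m → ℂ) → Fin m → ℂ := fun a l => ((-(t * N * Real.sin h) : ℝ) : ℂ) * D a l with hp
  have hpsq : ∀ a, (∑ l, ‖p a l‖ ^ 2) / 4 ≤ t ^ 2 * L ^ 2 := by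
    intro a
    simp only [hp, norm_mul, mul_pow, ← Finset.mul_sum, Complex.norm_real, Real.norm_eq_abs,
      sq_abs]
    have h1 : (N * Real.sin h) ^ 2 ≤ 4 := by
      have h2 : N * Real.sin h ≤ 2 := by
        calc N * Real.sin h ≤ N * h := by gcongr; exact Real.sin_le hh0
          _ ≤ 2 := by rw [hNh]; linarith [Real.pi_le_four]
      have h3 : 0 ≤ Real.sin h := by
        refine Real.sin_nonneg_of_nonneg_of_le_pi hh0 ?_
        have h4 : (1 : ℝ) ≤ N := by exact_mod_cast (by exact_mod_cast hN0 : 0 < N)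
        rw [hh, div_le_iff₀ (by positivity)]
        nlinarith [Real.pi_pos]
      have h5 : 0 ≤ N * Real.sin h := by positivity
      nlinarith
    calc (-(t * N * Real.sin h)) ^ 2 * (∑ l, ‖D a l‖ ^ 2) / 4
        = t ^ 2 * (N * Real.sin h) ^ 2 * (∑ l, ‖D a l‖ ^ 2) / 4 := by ring
      _ ≤ t ^ 2 * 4 * L ^ 2 / 4 := by gcongr; exact hD a
      _ = t ^ 2 * L ^ 2 := by ring
  set G : (Fin m → ℂ) × (Fin m → ℂ) → ℝ := fun q =>
    α * cnorm q.1 + (∑ l, p q.1 l * q.2 l).re with hG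
  have hpm : ∀ l, Measurable fun a => p a l := fun l => by
    have := (measurable_pi_apply l).comp hDm
    exact this.const_mul _
  have hGm : Measurable G := by
    have h1 : ∀ l, Measurable fun q : (Fin m → ℂ) × (Fin m → ℂ) => p q.1 l := fun l =>
      (hpm l).comp measurable_fst
    have h2 : Measurable fun q : (Fin m → ℂ) × (Fin m → ℂ) => ∑ l, p q.1 l * q.2 l :=
      Finset.measurable_sum _ fun l _ => (h1 l).mul (by fun_prop)
    exact Measurable.add (by fun_prop) (Complex.measurable_re.comp h2)
  set R : ℕ → (Fin m → ℂ) × (Fin m → ℂ) → (Fin m → ℂ) × (Fin m → ℂ) := fun j q =>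
    ContinuousLinearMap.rotation (E := Fin m → ℂ) (j * h) q with hR
  have hRm : ∀ j, Measurable (R j) := fun j =>
    (ContinuousLinearMap.rotation (E := Fin m → ℂ) (j * h)).continuous.measurable
  have hRint : ∀ j, ∫⁻ q, ENNReal.ofReal (Real.exp (G (R j q)))
      ∂((cgaussianVec m 1).prod (cgaussianVec m 1)) =
      ∫⁻ q, ENNReal.ofReal (Real.exp (G q)) ∂((cgaussianVec m 1).prod (cgaussianVec m 1)) := by
    intro j
    conv_rhs => rw [← map_rotation_cgaussianVec m (j * h)]
    rw [lintegral_map (by fun_prop) (hRm j)]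
  have hGint : ∫⁻ q, ENNReal.ofReal (Real.exp (G q))
      ∂((cgaussianVec m 1).prod (cgaussianVec m 1)) ≤
      ENNReal.ofReal (2 * Real.exp (t ^ 2 * L ^ 2)) := by
    rw [lintegral_prod _ (by fun_prop)]
    calc _ ≤ ∫⁻ a, ENNReal.ofReal (Real.exp (t ^ 2 * L ^ 2)) *
          ENNReal.ofReal (Real.exp (α * cnorm a)) ∂(cgaussianVec m 1) := by
          refine lintegral_mono fun a => ?_
          simp only [hG, Real.exp_add, ENNReal.ofReal_mul (Real.exp_nonneg _)]
          rw [lintegral_const_mul _ (by fun_prop), lintegral_exp_re_cgaussianVec, mul_comm]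
          gcongr
          exact hpsq a
      _ ≤ ENNReal.ofReal (Real.exp (t ^ 2 * L ^ 2)) * 2 := by
          rw [lintegral_const_mul _ (by fun_prop)]
          gcongr
          exact lintegral_exp_cnorm_le_two hα0 hα1
      _ = _ := by
          rw [mul_comm, ENNReal.ofReal_mul (by norm_num)]
          simp
  have hstep : ∀ j q, t * N * (F (R j q).1 - F (R (j + 1) q).1) ≤ G (R j q) := by
    intro j q
    have hrot : (R (j + 1) q).1 = Real.cos h • (R j q).1 + Real.sin h • (R j q).2 := by
      simp only [hR, ContinuousLinearMap.rotation_apply]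
      push_cast
      rw [add_mul, one_mul, Real.cos_add, Real.sin_add]
      ext l
      simp
      ring
    have h1 := hF (R j q).1 (R (j + 1) q).1
    have h2 : (∑ l, D (R j q).1 l * ((R j q).1 l - (R (j + 1) q).1 l)).re =
        (1 - Real.cos h) * (∑ l, D (R j q).1 l * (R j q).1 l).re -
          Real.sin h * (∑ l, D (R j q).1 l * (R j q).2 l).re := by
      rw [hrot, ← Complex.re_ofReal_mul, ← Complex.re_ofReal_mul, ← Complex.sub_re,
        Finset.mul_sum, Finset.mul_sum, ← Finset.sum_sub_distrib]
      congr 1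
      refine Finset.sum_congr rfl fun l _ => ?_
      simp
      ring
    have h3 := re_sum_mul_le hL (D (R j q).1) (R j q).1 (hD _)
    have h4 : G (R j q) = α * cnorm (R j q).1 -
        t * N * Real.sin h * (∑ l, D (R j q).1 l * (R j q).2 l).re := by
      simp only [hG, hp, mul_assoc ((-(t * N * Real.sin h) : ℝ) : ℂ), ← Finset.mul_sum,
        Complex.re_ofReal_mul]
      ring
    rw [h4, hα]
    rw [h2] at h1
    calc _ ≤ t * N * ((1 - Real.cos h) * (L * cnorm (R j q).1) -
          Real.sin h * (∑ l, D (R j q).1 l * (R j q).2 l).re) := by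
          refine mul_le_mul_of_nonneg_left (h1.trans ?_) (by positivity)
          linarith [mul_le_mul_of_nonneg_left h3 hcos]
      _ = _ := by ring
  have hsum : ∀ q, t * (F q.1 - F q.2) =
      ∑ j ∈ Finset.range N, (1 / N : ℝ) * (t * N * (F (R j q).1 - F (R (j + 1) q).1)) := by
    intro q
    have h0 : R 0 q = q := by
      ext <;> simp [hR, ContinuousLinearMap.rotation_apply]
    have hNR : (R N q).1 = q.2 := by
      simp [hR, ContinuousLinearMap.rotation_apply, hNh]
    have h1 : ∀ j, (1 / N : ℝ) * (t * N * (F (R j q).1 - F (R (j + 1) q).1)) =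
        t * (F (R j q).1 - F (R (j + 1) q).1) := fun j => by field_simp
    simp_rw [h1]
    rw [← Finset.mul_sum, Finset.sum_range_sub', h0, hNR]
  have hjensen : ∀ q, ENNReal.ofReal (Real.exp (t * (F q.1 - F q.2))) ≤
      ∑ j ∈ Finset.range N, ENNReal.ofReal (1 / N) * ENNReal.ofReal (Real.exp (G (R j q))) := by
    intro q
    rw [hsum q]
    have h1 := convexOn_exp.map_sum_le (t := Finset.range N) (w := fun _ => (1 / N : ℝ))
      (p := fun j => t * N * (F (R j q).1 - F (R (j + 1) q).1)) (fun _ _ => by positivity)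
      (by simp [hN0.ne']) (fun _ _ => Set.mem_univ _)
    simp only [smul_eq_mul] at h1
    refine (ENNReal.ofReal_le_ofReal h1).trans ?_
    rw [ENNReal.ofReal_sum_of_nonneg fun _ _ => by positivity]
    refine Finset.sum_le_sum fun j _ => ?_
    rw [ENNReal.ofReal_mul (by positivity)]
    gcongr
    exact hstep j q
  refine (lintegral_mono hjensen).trans ?_
  have hm2 : ∀ j, Measurable fun q => ENNReal.ofReal (Real.exp (G (R j q))) := fun j =>
    (hGm.comp (hRm j)).exp.ennreal_ofReal
  rw [lintegral_finsetSum _ fun j _ => (hm2 j).const_mul _]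
  calc _ ≤ ∑ j ∈ Finset.range N, ENNReal.ofReal (1 / N) *
        ENNReal.ofReal (2 * Real.exp (t ^ 2 * L ^ 2)) := by
        refine Finset.sum_le_sum fun j _ => ?_
        rw [lintegral_const_mul _ (hm2 j), hRint]
        gcongr
    _ = _ := by
        rw [← Finset.sum_mul, Finset.sum_const, Finset.card_range, nsmul_eq_mul,
          ← ENNReal.ofReal_natCast, ← ENNReal.ofReal_mul hN0.le, mul_one_div_cancel hN0.ne',
          ENNReal.ofReal_one, one_mul]

/-- Gaussian concentration above a multiple of the root mean square, for nonnegative functions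
admitting subgradients of norm at most `L`. -/
lemma measure_ge_le_of_subgradient {m : ℕ} (F : (Fin m → ℂ) → ℝ) (hFm : Measurable F)
    (D : (Fin m → ℂ) → Fin m → ℂ) (hDm : Measurable D) {L K t : ℝ}
    (hL : 0 < L) (ht : 0 ≤ t) (hK : 0 < K)
    (hD : ∀ a, ∑ l, ‖D a l‖ ^ 2 ≤ L ^ 2)
    (hF : ∀ a b, F a - F b ≤ (∑ l, D a l * (a l - b l)).re)
    (hFK : ∫⁻ a, ENNReal.ofReal (F a ^ 2) ∂(cgaussianVec m 1) ≤ ENNReal.ofReal (K ^ 2)) :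
    cgaussianVec m 1 {a | 2 * K + t ≤ F a} ≤ ENNReal.ofReal (3 * Real.exp (-(t ^ 2 / (4 * L ^ 2)))) := by
  set μ := cgaussianVec m 1 with hμ
  have hlowm : MeasurableSet {a | F a ≤ 2 * K} := measurableSet_le hFm measurable_const
  have hlow : ENNReal.ofReal (3 / 4) ≤ μ {a | F a ≤ 2 * K} := by
    have h1 : ENNReal.ofReal (4 * K ^ 2) * μ {a | F a ≤ 2 * K}ᶜ ≤ ENNReal.ofReal (K ^ 2) := by
      refine le_trans ?_ ((mul_meas_ge_le_lintegral (μ := μ)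
        (f := fun a => ENNReal.ofReal (F a ^ 2)) (by fun_prop)
        (ENNReal.ofReal (4 * K ^ 2))).trans hFK)
      gcongr
      intro a ha
      have ha' : 2 * K < F a := not_le.1 ha
      refine ENNReal.ofReal_le_ofReal ?_
      nlinarith
    have h2 : μ {a | F a ≤ 2 * K}ᶜ ≤ ENNReal.ofReal (1 / 4) := by
      have h3 : ENNReal.ofReal (K ^ 2) = ENNReal.ofReal (4 * K ^ 2) * ENNReal.ofReal (1 / 4) := by
        rw [← ENNReal.ofReal_mul (by positivity)]; congr 1; ring
      rw [h3] at h1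
      exact (ENNReal.mul_le_mul_iff_right (ENNReal.ofReal_pos.2 (by positivity)).ne'
        ENNReal.ofReal_ne_top).1 h1
    have h4 : (1 : ℝ≥0∞) = μ {a | F a ≤ 2 * K} + μ {a | F a ≤ 2 * K}ᶜ := by
      rw [measure_add_measure_compl hlowm, hμ, measure_univ]
    have h5 : ENNReal.ofReal (3 / 4) + ENNReal.ofReal (1 / 4) ≤
        μ {a | F a ≤ 2 * K} + ENNReal.ofReal (1 / 4) := by
      rw [← ENNReal.ofReal_add (by norm_num) (by norm_num)]
      norm_num
      rw [h4]
      gcongr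
    exact (ENNReal.add_le_add_iff_right (by simp)).1 h5
  set s := t / (2 * L ^ 2) with hs
  have hs0 : 0 ≤ s := by positivity
  have hmain := lintegral_exp_diff_le F D hDm hL.le hs0 hD hF
  have hmark := (mul_meas_ge_le_lintegral
    (μ := (cgaussianVec m 1).prod (cgaussianVec m 1))
    (f := fun q => ENNReal.ofReal (Real.exp (s * (F q.1 - F q.2)))) (by fun_prop)
    (ENNReal.ofReal (Real.exp (s * t)))).trans hmain
  have hsub : {a | 2 * K + t ≤ F a} ×ˢ {a | F a ≤ 2 * K} ⊆
      {q : (Fin m → ℂ) × (Fin m → ℂ) | ENNReal.ofReal (Real.exp (s * t)) ≤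
        ENNReal.ofReal (Real.exp (s * (F q.1 - F q.2)))} := by
    rintro q ⟨h1, h2⟩
    have h1' : 2 * K + t ≤ F q.1 := h1
    have h2' : F q.2 ≤ 2 * K := h2
    refine ENNReal.ofReal_le_ofReal (Real.exp_le_exp.2 ?_)
    gcongr
    linarith
  have h6 : ENNReal.ofReal (Real.exp (s * t)) * (μ {a | 2 * K + t ≤ F a} *
      ENNReal.ofReal (3 / 4)) ≤ ENNReal.ofReal (2 * Real.exp (s ^ 2 * L ^ 2)) := by
    refine le_trans ?_ hmark
    gcongr
    refine le_trans ?_ (measure_mono hsub)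
    rw [Measure.prod_prod]
    gcongr
  rw [mul_comm (μ _), ← mul_assoc, ← ENNReal.ofReal_mul (by positivity)] at h6
  have h7 : ENNReal.ofReal (2 * Real.exp (s ^ 2 * L ^ 2)) ≤
      ENNReal.ofReal (Real.exp (s * t) * (3 / 4)) *
        ENNReal.ofReal (3 * Real.exp (-(t ^ 2 / (4 * L ^ 2)))) := by
    rw [← ENNReal.ofReal_mul (by positivity)]
    refine ENNReal.ofReal_le_ofReal ?_
    have h8 : Real.exp (s * t) * (3 / 4) * (3 * Real.exp (-(t ^ 2 / (4 * L ^ 2)))) =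
        9 / 4 * Real.exp (s ^ 2 * L ^ 2) := by
      rw [show Real.exp (s * t) * (3 / 4) * (3 * Real.exp (-(t ^ 2 / (4 * L ^ 2)))) =
        9 / 4 * (Real.exp (s * t) * Real.exp (-(t ^ 2 / (4 * L ^ 2)))) by ring, ← Real.exp_add]
      congr 2
      rw [hs]; field_simp; ring
    rw [h8]
    have := Real.exp_nonneg (s ^ 2 * L ^ 2)
    linarith
  refine (ENNReal.mul_le_mul_iff_right ?_ (by simp)).1 (h6.trans h7)
  simpa using mul_pos (Real.exp_pos (s * t)) (by norm_num : (0 : ℝ) < 3 / 4)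

/-! ### Nets for the Euclidean ball by empirical averages -/

lemma exists_sum_exp_le {ι κ : Type*} [Fintype ι] [Fintype κ] (p : ι → ℝ) (hp : ∀ i, 0 ≤ p i)
    (hp1 : ∑ i, p i = 1) (f : ι → κ → ℝ) (hf0 : ∀ k, ∑ i, p i * f i k = 0) {b lm : ℝ}
    (hf : ∀ i k, |f i k| ≤ b) (hlm : 0 ≤ lm) (hlb : lm * b ≤ 1) (M : ℕ) :
    ∃ s : Fin M → ι, ∑ k, Real.exp (lm * ∑ i, f (s i) k) ≤
      Fintype.card κ * Real.exp (M * (lm * b) ^ 2) := by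
  induction M with
  | zero => exact ⟨Fin.elim0, by simp⟩
  | succ M ih =>
    obtain ⟨s, hs⟩ := ih
    by_contra! hcon
    set B := Fintype.card κ * Real.exp (((M + 1 : ℕ) : ℝ) * (lm * b) ^ 2) with hB
    have hcon' : ∀ i, B < ∑ k, Real.exp (lm * ∑ j, f (s j) k) * Real.exp (lm * f i k) := by
      intro i
      refine (hcon (Fin.snoc s i)).trans_eq (Finset.sum_congr rfl fun k _ => ?_)
      rw [← Real.exp_add, Fin.sum_univ_castSucc]
      simp [mul_add]
    have h1 : ∀ i k, Real.exp (lm * f i k) ≤ 1 + lm * f i k + (lm * b) ^ 2 := by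
      intro i k
      have hab : |lm * f i k| ≤ lm * b := by
        rw [abs_mul, abs_of_nonneg hlm]; gcongr; exact hf i k
      have h2 := Real.abs_exp_sub_one_sub_id_le (hab.trans hlb)
      have h3 : (lm * f i k) ^ 2 ≤ (lm * b) ^ 2 := sq_le_sq' (by linarith [abs_le.1 hab])
        (abs_le.1 hab).2
      linarith [(abs_le.1 h2).2]
    have h4 : ∑ i, p i * ∑ k, Real.exp (lm * ∑ j, f (s j) k) * Real.exp (lm * f i k) ≤ B := by
      calc _ ≤ ∑ i, p i * ∑ k, Real.exp (lm * ∑ j, f (s j) k) *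
            (1 + lm * f i k + (lm * b) ^ 2) := by
            gcongr with i _ k _
            · exact hp i
            · exact h1 i k
        _ = ∑ k, Real.exp (lm * ∑ j, f (s j) k) *
            ∑ i, (p i * (1 + (lm * b) ^ 2) + lm * (p i * f i k)) := by
            simp_rw [Finset.mul_sum]
            rw [Finset.sum_comm]
            refine Finset.sum_congr rfl fun k _ => Finset.sum_congr rfl fun i _ => ?_
            ring
        _ = ∑ k, Real.exp (lm * ∑ j, f (s j) k) * (1 + (lm * b) ^ 2) := by
            simp_rw [Finset.sum_add_distrib, ← Finset.mul_sum, ← Finset.sum_mul, hp1, hf0]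
            simp [Finset.sum_mul]
        _ ≤ (Fintype.card κ * Real.exp (M * (lm * b) ^ 2)) * Real.exp ((lm * b) ^ 2) := by
            rw [← Finset.sum_mul]
            gcongr
            linarith [Real.add_one_le_exp ((lm * b) ^ 2)]
        _ = B := by
            rw [hB, mul_assoc, ← Real.exp_add]; push_cast; ring_nf
    have h5 : B < ∑ i, p i * ∑ k, Real.exp (lm * ∑ j, f (s j) k) * Real.exp (lm * f i k) := by
      obtain ⟨i₀, -, hi₀⟩ := Finset.exists_ne_zero_of_sum_ne_zero
        (show ∑ i, p i ≠ 0 by rw [hp1]; norm_num)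
      calc B = ∑ i, p i * B := by rw [← Finset.sum_mul, hp1, one_mul]
        _ < _ := Finset.sum_lt_sum
            (fun i _ => mul_le_mul_of_nonneg_left (hcon' i).le (hp i))
            ⟨i₀, Finset.mem_univ _, mul_lt_mul_of_pos_left (hcon' i₀)
              ((hp i₀).lt_of_ne' hi₀)⟩
    linarith

lemma exists_average_le {ι κ : Type*} [Fintype ι] [Fintype κ] (p : ι → ℝ) (hp : ∀ i, 0 ≤ p i)
    (hp1 : ∑ i, p i = 1) (f : ι → κ → ℝ) (hf0 : ∀ k, ∑ i, p i * f i k = 0) {b l : ℝ}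
    (hb : 0 < b) (hf : ∀ i k, |f i k| ≤ b) (hl : 0 < l) (hl1 : (Fintype.card κ : ℝ) ≤ Real.exp l)
    {M : ℕ} (hM : l ≤ M) :
    ∃ s : Fin M → ι, ∀ k, ∑ i, f (s i) k ≤ 2 * b * Real.sqrt (l * M) := by
  have hM0 : (0 : ℝ) < M := hl.trans_le hM
  set lm := Real.sqrt (l / M) / b with hlm
  have hlb : lm * b = Real.sqrt (l / M) := by rw [hlm]; field_simp
  have hlm0 : 0 < lm := by positivity
  obtain ⟨s, hs⟩ := exists_sum_exp_le p hp hp1 f hf0 hf hlm0.le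
    (by rw [hlb]; exact Real.sqrt_le_one.2 ((div_le_one hM0).2 hM)) M
  refine ⟨s, fun k => ?_⟩
  have h1 : Real.exp (lm * ∑ i, f (s i) k) ≤ Real.exp (2 * l) := by
    calc _ ≤ _ := Finset.single_le_sum (f := fun k => Real.exp (lm * ∑ i, f (s i) k))
          (fun _ _ => by positivity) (Finset.mem_univ k)
      _ ≤ _ := hs
      _ ≤ Real.exp l * Real.exp l := by
          rw [hlb, Real.sq_sqrt (by positivity), mul_div_cancel₀ _ hM0.ne']
          gcongr
      _ = _ := by rw [← Real.exp_add]; ring_nf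
  have h2 := Real.exp_le_exp.1 h1
  refine le_of_mul_le_mul_left (h2.trans_eq ?_) hlm0
  have h3 : Real.sqrt (l / M) * Real.sqrt (l * M) = l := by
    rw [← Real.sqrt_mul (by positivity), show l / M * (l * M) = l ^ 2 by field_simp,
      Real.sqrt_sq hl.le]
  calc 2 * l = 2 * (Real.sqrt (l / M) * Real.sqrt (l * M)) := by rw [h3]
    _ = 2 * (lm * b * Real.sqrt (l * M)) := by rw [hlb]
    _ = _ := by ring

/-- The four unit directions of the complex plane. -/
def unitDir : Fin 4 → ℂ := ![1, I, -1, -I]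

lemma norm_unitDir (q : Fin 4) : ‖unitDir q‖ = 1 := by
  fin_cases q <;> simp [unitDir]

lemma norm_le_of_unitDir {z : ℂ} {ε : ℝ} (hz : ∀ q, (unitDir q * z).re ≤ ε) : ‖z‖ ≤ 2 * ε := by
  have h0 := hz 0
  have h1 := hz 1
  have h2 := hz 2
  have h3 := hz 3
  simp [unitDir] at h0 h1 h2 h3
  have h4 := Complex.norm_le_abs_re_add_abs_im z
  have h5 : |z.re| ≤ ε := abs_le.2 ⟨by linarith, h0⟩
  have h6 : |z.im| ≤ ε := abs_le.2 ⟨by linarith, by linarith⟩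
  linarith

/-- Every vector of the unit ball is an average of vectors `2√n · unitDir q · e_j`. -/
lemma exists_weights {n : ℕ} (hn : 0 < n) (w : Fin n → ℂ) (hw : cnorm w ≤ 1) :
    ∃ p : Fin n × Fin 4 → ℝ, (∀ i, 0 ≤ p i) ∧ ∑ i, p i = 1 ∧
      ∀ χ : Fin n → ℂ, ∑ i, (p i : ℂ) * (2 * Real.sqrt n * unitDir i.2 * χ i.1) =
        ∑ j, w j * χ j := by
  have hn' : (0 : ℝ) < n := by exact_mod_cast hn
  set B := 2 * Real.sqrt n with hB
  have hB0 : 0 < B := by positivity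
  set c : Fin n → Fin 4 → ℝ := fun j => ![(w j).re, (w j).im, -(w j).re, -(w j).im] with hc
  set S := ∑ j, (|(w j).re| + |(w j).im|) / B with hS
  have hS1 : S ≤ 1 := by
    rw [hS, ← Finset.sum_div, div_le_one hB0]
    calc ∑ j, (|(w j).re| + |(w j).im|) ≤ ∑ j, 2 * ‖w j‖ := by
          gcongr with j _
          linarith [Complex.abs_re_le_norm (w j), Complex.abs_im_le_norm (w j)]
      _ ≤ 2 * (Real.sqrt n * cnorm w) := by
          rw [← Finset.mul_sum]; gcongr; exact sum_norm_le_sqrt w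
      _ ≤ 2 * (Real.sqrt n * 1) := by gcongr
      _ = B := by rw [hB]; ring
  set r := (1 - S) / (4 * n) with hr
  have hr0 : 0 ≤ r := div_nonneg (by linarith) (by positivity)
  refine ⟨fun i => (|c i.1 i.2| + c i.1 i.2) / (2 * B) + r, fun i => ?_, ?_, fun χ => ?_⟩
  · have := neg_abs_le (c i.1 i.2)
    have : 0 ≤ |c i.1 i.2| + c i.1 i.2 := by linarith
    positivity
  · rw [Fintype.sum_prod_type]
    simp only [Fin.sum_univ_four, hc]
    have : ∀ j, (|(w j).re| + (w j).re) / (2 * B) + r + ((|(w j).im| + (w j).im) / (2 * B) + r) +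
        ((|-(w j).re| + -(w j).re) / (2 * B) + r) + ((|-(w j).im| + -(w j).im) / (2 * B) + r) =
        (|(w j).re| + |(w j).im|) / B + 4 * r := by
      intro j; rw [abs_neg, abs_neg]; field_simp; ring
    simp only [Matrix.cons_val]
    simp_rw [this]
    rw [Finset.sum_add_distrib, ← hS, Finset.sum_const, Finset.card_univ, Fintype.card_fin, hr,
      nsmul_eq_mul]
    field_simp
    ring
  · rw [Fintype.sum_prod_type]
    refine Finset.sum_congr rfl fun j _ => ?_
    simp only [Fin.sum_univ_four, hc, unitDir, Matrix.cons_val]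
    have hBc : (2 * (Real.sqrt n : ℂ)) = (B : ℂ) := by rw [hB]; push_cast; ring
    have hB1 : (B : ℂ) ≠ 0 := by exact_mod_cast hB0.ne'
    rw [hBc]
    simp only [abs_neg, ofReal_add, ofReal_div, ofReal_mul, ofReal_neg, ofReal_ofNat]
    field_simp
    simp
    linear_combination (-(2 * χ j)) * (Complex.re_add_im (w j)).symm

lemma exists_average_close {n : ℕ} (hn : 0 < n) {X : Type*} [Fintype X]
    (χ : X → Fin n → ℂ) (hχ : ∀ x j, ‖χ x j‖ ≤ 1) {l : ℝ} (hl : 0 < l)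
    (hX : (4 * Fintype.card X : ℝ) ≤ Real.exp l) {M : ℕ} (hM : l ≤ M)
    (w : Fin n → ℂ) (hw : cnorm w ≤ 1) :
    ∃ s : Fin M → Fin n × Fin 4, ∀ x,
      ‖∑ i, 2 * Real.sqrt n * unitDir (s i).2 * χ x (s i).1 - M * ∑ j, w j * χ x j‖ ≤
        16 * Real.sqrt (n * l * M) := by
  have hn' : (0 : ℝ) < n := by exact_mod_cast hn
  obtain ⟨p, hp, hp1, hpw⟩ := exists_weights hn w hw
  set f : Fin n × Fin 4 → X × Fin 4 → ℝ := fun i k =>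
    (unitDir k.2 * (2 * Real.sqrt n * unitDir i.2 * χ k.1 i.1 - ∑ j, w j * χ k.1 j)).re with hf
  have hb : ∀ i k, |f i k| ≤ 4 * Real.sqrt n := by
    intro i k
    refine (Complex.abs_re_le_norm _).trans ?_
    rw [norm_mul, norm_unitDir, one_mul]
    have h1 : ‖∑ j, w j * χ k.1 j‖ ≤ Real.sqrt n := by
      calc _ ≤ ∑ j, ‖w j‖ := (norm_sum_le _ _).trans (Finset.sum_le_sum fun j _ => by
            rw [norm_mul]; exact mul_le_of_le_one_right (norm_nonneg _) (hχ _ _))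
        _ ≤ Real.sqrt n * 1 := (sum_norm_le_sqrt w).trans (by gcongr)
        _ = _ := mul_one _
    have h2 : ‖2 * (Real.sqrt n : ℂ) * unitDir i.2 * χ k.1 i.1‖ ≤ 2 * Real.sqrt n := by
      rw [norm_mul, norm_mul, norm_unitDir, mul_one, norm_mul, Complex.norm_real, Real.norm_eq_abs,
        abs_of_nonneg (Real.sqrt_nonneg _)]
      simpa using mul_le_of_le_one_right (show 0 ≤ 2 * Real.sqrt n by positivity) (hχ k.1 i.1)
    have := norm_sub_le (2 * (Real.sqrt n : ℂ) * unitDir i.2 * χ k.1 i.1) (∑ j, w j * χ k.1 j)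
    have := Real.sqrt_nonneg n
    linarith
  have hf0 : ∀ k, ∑ i, p i * f i k = 0 := by
    intro k
    simp only [hf, ← Complex.re_ofReal_mul]
    rw [← Complex.re_sum]
    have : ∀ i, (p i : ℂ) * (unitDir k.2 * (2 * Real.sqrt n * unitDir i.2 * χ k.1 i.1 -
        ∑ j, w j * χ k.1 j)) = unitDir k.2 * ((p i : ℂ) * (2 * Real.sqrt n * unitDir i.2 * χ k.1 i.1)) -
        unitDir k.2 * (∑ j, w j * χ k.1 j) * (p i : ℂ) := fun i => by ring
    simp_rw [this]
    rw [Finset.sum_sub_distrib, ← Finset.mul_sum, ← Finset.mul_sum, hpw, ← Complex.ofReal_sum, hp1]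
    simp
  obtain ⟨s, hs⟩ := exists_average_le p hp hp1 f hf0 (b := 4 * Real.sqrt n) (by positivity) hb hl
    (by simpa [mul_comm] using hX) hM
  refine ⟨s, fun x => ?_⟩
  have h3 : ∀ q, (unitDir q * (∑ i, 2 * Real.sqrt n * unitDir (s i).2 * χ x (s i).1 -
      M * ∑ j, w j * χ x j)).re ≤ 8 * Real.sqrt (n * l * M) := by
    intro q
    have h4 := hs (x, q)
    simp only [hf] at h4
    rw [← Complex.re_sum, ← Finset.mul_sum, Finset.sum_sub_distrib] at h4
    simp only [Finset.sum_const, Finset.card_univ, Fintype.card_fin, nsmul_eq_mul] at h4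
    refine h4.trans_eq ?_
    rw [show (n : ℝ) * l * M = n * (l * M) by ring, Real.sqrt_mul hn'.le]
    ring
  exact (norm_le_of_unitDir h3).trans_eq (by ring)

lemma exists_net {n : ℕ} (hn : 0 < n) {X : Type*} [Fintype X]
    (χ : X → Fin n → ℂ) (hχ : ∀ x j, ‖χ x j‖ ≤ 1) {l : ℝ} (hl : 0 < l)
    (hX : (4 * Fintype.card X : ℝ) ≤ Real.exp l) {M : ℕ} (hM : l ≤ M) :
    ∃ N : Finset (Fin n → ℂ), N.card ≤ (4 * n) ^ M ∧ (∀ v ∈ N, cnorm v ≤ 1) ∧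
      ∀ w : Fin n → ℂ, cnorm w ≤ 1 → ∃ v ∈ N, ∀ x,
        ‖∑ j, (w j - v j) * χ x j‖ ≤ 32 * Real.sqrt (n * l / M) := by
  classical
  have hM0 : (0 : ℝ) < M := hl.trans_le hM
  set P : (Fin M → Fin n × Fin 4) → (Fin n → ℂ) → Prop := fun s w => cnorm w ≤ 1 ∧ ∀ x,
      ‖∑ i, 2 * Real.sqrt n * unitDir (s i).2 * χ x (s i).1 - M * ∑ j, w j * χ x j‖ ≤
        16 * Real.sqrt (n * l * M) with hP
  set g : (Fin M → Fin n × Fin 4) → Fin n → ℂ := fun s =>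
    if hs : ∃ w, P s w then hs.choose else 0 with hg
  refine ⟨Finset.univ.image g, Finset.card_image_le.trans_eq (by simp [mul_comm]), ?_,
    fun w hw => ?_⟩
  · intro v hv
    obtain ⟨s, -, rfl⟩ := Finset.mem_image.1 hv
    by_cases hs : ∃ w, P s w
    · simp only [hg, dif_pos hs]; exact hs.choose_spec.1
    · simp only [hg, dif_neg hs]; simp [cnorm]
  · obtain ⟨s, hs⟩ := exists_average_close hn χ hχ hl hX hM w hw
    have hex : ∃ w, P s w := ⟨w, hw, hs⟩
    refine ⟨g s, Finset.mem_image_of_mem _ (Finset.mem_univ _), fun x => ?_⟩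
    have hgs : P s (g s) := by simp only [hg, dif_pos hex]; exact hex.choose_spec
    have h1 := norm_sub_le_norm_sub_add_norm_sub
      (M * ∑ j, w j * χ x j) (∑ i, 2 * (Real.sqrt n : ℂ) * unitDir (s i).2 * χ x (s i).1)
      (M * ∑ j, g s j * χ x j)
    rw [norm_sub_rev (M * ∑ j, w j * χ x j)
      (∑ i, 2 * (Real.sqrt n : ℂ) * unitDir (s i).2 * χ x (s i).1)] at h1
    have h2 : ‖∑ j, (w j - g s j) * χ x j‖ * M ≤ 32 * Real.sqrt (n * l * M) := by
      have h3 : (∑ j, (w j - g s j) * χ x j) * M =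
          M * ∑ j, w j * χ x j - M * ∑ j, g s j * χ x j := by
        simp_rw [sub_mul]; rw [Finset.sum_sub_distrib]; ring
      have h5 : ‖∑ j, (w j - g s j) * χ x j‖ * M = ‖(∑ j, (w j - g s j) * χ x j) * M‖ := by
        rw [norm_mul, Complex.norm_natCast]
      rw [h5, h3]
      linarith [hs x, hgs.2 x]
    refine le_of_mul_le_mul_right (h2.trans_eq ?_) hM0
    rw [show (n : ℝ) * l * M = n * l / M * M ^ 2 by field_simp, Real.sqrt_mul (by positivity),
      Real.sqrt_sq hM0.le]
    ring

/-! ### Uniform control of the soft-thresholded norm by chaining -/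

lemma measure_softNorm_cconv_ge {m : ℕ} [NeZero m] (u : Fin m → ℂ) (hu : ∑ l, ‖u l‖ ^ 2 ≤ 4)
    {L : ℝ} (hL : 0 < L) (huL : ∀ ψ, ‖fhat ψ u‖ ≤ L) {θ t : ℝ} (hθ : 0 ≤ θ) (ht : 0 ≤ t) :
    cgaussianVec m 1 {a | 8 * Real.sqrt m * Real.exp (-(θ ^ 2 / 16)) + t ≤
        softNorm θ (cconv a u)} ≤ ENNReal.ofReal (3 * Real.exp (-(t ^ 2 / (4 * L ^ 2)))) := by
  have hm : (0 : ℝ) < m := by exact_mod_cast NeZero.pos m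
  have hmc : Measurable fun a => cconv a u := measurable_cconv u
  have := measure_ge_le_of_subgradient (fun a => softNorm θ (cconv a u)) (by fun_prop)
    (convGrad θ u) (measurable_convGrad θ u) (L := L)
    (K := 4 * Real.sqrt m * Real.exp (-(θ ^ 2 / 16))) hL ht (by positivity)
    (fun a => convGrad_sq_le u a hL.le (cnorm_cconv_le hL.le u huL))
    (softNorm_cconv_sub_le hθ u) ?_
  · refine le_of_eq_of_le ?_ this
    congr 1
    ext a
    rw [Set.mem_ofPred_eq, Set.mem_ofPred_eq]
    ring_nf
  · simp only [softNorm, rnorm_sq]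
    have hk : ∀ k, ∫⁻ a, ENNReal.ofReal (max (‖cconv a u k‖ - θ) 0 ^ 2) ∂(cgaussianVec m 1) ≤
        ENNReal.ofReal (4 * 4 * Real.exp (-θ ^ 2 / (2 * 4))) := by
      intro k
      simp only [cconv_comm]
      exact lintegral_trunc_sq_linearForm (fun l => u (k - l)) (by norm_num) hθ
        (by rw [sum_norm_sq_shift]; exact hu)
    simp_rw [ENNReal.ofReal_sum_of_nonneg fun _ _ => sq_nonneg _]
    rw [lintegral_finsetSum _ fun k _ => by
      have : Measurable fun a => cconv a u k := (measurable_pi_apply k).comp hmc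
      fun_prop]
    refine (Finset.sum_le_sum fun k _ => hk k).trans_eq ?_
    rw [Finset.sum_const, Finset.card_univ, Fintype.card_fin, nsmul_eq_mul,
      ← ENNReal.ofReal_natCast, ← ENNReal.ofReal_mul hm.le]
    congr 1
    rw [mul_pow, mul_pow, Real.sq_sqrt hm.le, ← Real.exp_nat_mul]
    ring_nf

lemma one_le_log_natCast {m : ℕ} (hm : 4 ≤ m) : 1 ≤ Real.log m := by
  have h4 : (4 : ℝ) ≤ m := by exact_mod_cast hm
  rw [Real.le_log_iff_exp_le (by linarith)]
  linarith [Real.exp_one_lt_d9]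

lemma exists_net_fhat {n m : ℕ} [NeZero m] (hn : 0 < n) (h : n ≤ m) (hm : 4 ≤ m) {R : ℝ}
    (hR : 1 ≤ R) (i : ℕ) :
    ∃ N : Finset (Fin n → ℂ), (N.card : ℝ) ≤ Real.exp (8 * Real.log m ^ 2 * R ^ (2 * i)) ∧
      (∀ v ∈ N, cnorm v ≤ 1) ∧ (i = 0 → ∀ v ∈ N, v = 0) ∧
      ∀ w : Fin n → ℂ, cnorm w ≤ 1 → ∃ v ∈ N, ∀ ψ : AddChar (Fin m) ℂ,
        ‖fhat ψ (pad m (w - v))‖ ≤ 32 * Real.sqrt n / R ^ i := by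
  have hm4 : (4 : ℝ) ≤ m := by exact_mod_cast hm
  have hl1 := one_le_log_natCast hm
  have hR2 : 1 ≤ R ^ (2 * i) := one_le_pow₀ hR
  rcases Nat.eq_zero_or_pos i with rfl | hi
  · refine ⟨{0}, ?_, by simp [cnorm], by simp, fun w hw => ⟨0, by simp, fun ψ => ?_⟩⟩
    · simp only [Finset.card_singleton, Nat.cast_one]
      exact Real.one_le_exp (by positivity)
    · rw [sub_zero]
      calc _ ≤ Real.sqrt n * 1 := (norm_fhat_pad_le h ψ w).trans (by gcongr)
        _ ≤ _ := by rw [pow_zero, div_one]; nlinarith [Real.sqrt_nonneg n]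
  set l := Real.log (4 * m) with hl
  have hll : l ≤ 2 * Real.log m := by
    rw [hl, Real.log_mul (by norm_num) (by positivity)]
    linarith [Real.log_le_log (by norm_num) hm4]
  have hlpos : 1 ≤ l := hl1.trans (Real.log_le_log (by positivity) (by linarith))
  obtain ⟨N, hN1, hN2, hN3⟩ := exists_net hn
    (fun (ψ : AddChar (Fin m) ℂ) (j : Fin n) => ψ (Fin.castLE h j)) (fun ψ j => by simp)
    (l := l) (by linarith) (by
      rw [← Nat.card_eq_fintype_card, hl, Real.exp_log (by positivity), Nat.card_eq_fintype_card,
        AddChar.card_eq]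
      simp)
    (M := ⌈l * R ^ (2 * i)⌉₊) ((le_mul_of_one_le_right (by linarith) hR2).trans (Nat.le_ceil _))
  refine ⟨N, ?_, hN2, fun h0 => absurd h0 hi.ne', fun w hw => ?_⟩
  · have h1 : (N.card : ℝ) ≤ (4 * n : ℝ) ^ ⌈l * R ^ (2 * i)⌉₊ := by exact_mod_cast hN1
    refine h1.trans ?_
    have h2 : (4 * n : ℝ) ≤ Real.exp l := by
      rw [hl, Real.exp_log (by positivity)]
      have : (n : ℝ) ≤ m := by exact_mod_cast h
      linarith
    calc (4 * n : ℝ) ^ ⌈l * R ^ (2 * i)⌉₊ ≤ Real.exp l ^ ⌈l * R ^ (2 * i)⌉₊ := by gcongr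
      _ = Real.exp (⌈l * R ^ (2 * i)⌉₊ * l) := by rw [← Real.exp_nat_mul]
      _ ≤ _ := by
        refine Real.exp_le_exp.2 ?_
        have h3 : (⌈l * R ^ (2 * i)⌉₊ : ℝ) ≤ 2 * (l * R ^ (2 * i)) := by
          have := (Nat.ceil_lt_add_one (show 0 ≤ l * R ^ (2 * i) by positivity)).le
          nlinarith
        calc _ ≤ 2 * (l * R ^ (2 * i)) * l := by gcongr
          _ = 2 * l ^ 2 * R ^ (2 * i) := by ring
          _ ≤ 2 * (2 * Real.log m) ^ 2 * R ^ (2 * i) := by gcongr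
          _ = _ := by ring
  · obtain ⟨v, hv, hvx⟩ := hN3 w hw
    refine ⟨v, hv, fun ψ => ?_⟩
    rw [fhat, sum_pad h (w - v) (fun i z => z * ψ i) (by simp)]
    refine (hvx ψ).trans ?_
    rw [mul_div_assoc 32]
    refine mul_le_mul_of_nonneg_left (Real.sqrt_le_iff.2 ⟨by positivity, ?_⟩) (by norm_num)
    rw [div_pow, Real.sq_sqrt (by positivity), ← pow_mul, mul_comm i 2, mul_div_assoc]
    rw [div_eq_mul_one_div (n : ℝ) (R ^ (2 * i))]
    refine mul_le_mul_of_nonneg_left ?_ (by positivity)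
    have hp : 0 < l * R ^ (2 * i) := by positivity
    rw [div_le_div_iff₀ (hp.trans_le (Nat.le_ceil _)) (by positivity), one_mul]
    exact Nat.le_ceil _

/-- Uniform bound on the soft-thresholded norm of `A w` over the unit ball. -/
lemma measure_softNorm_sup_le {n m : ℕ} (hn : 0 < n) (h : n ≤ m) (hm : 4 ≤ m) {R θ : ℝ}
    (hR : 2 ≤ R) (hθ : 0 ≤ θ) (J : ℕ) :
    cgaussianVec m 1 {a | ¬ ∀ w : Fin n → ℂ, cnorm w ≤ 1 →
        softNorm (J * θ) ((Amat h a).mulVec w) ≤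
          J * (8 * Real.sqrt m * Real.exp (-(θ ^ 2 / 16)) + 512 * R * Real.sqrt n * Real.log m) +
            64 * Real.sqrt n * Real.sqrt m / R ^ J} ≤
      ENNReal.ofReal (3 * J / (m : ℝ) ^ 2 + 1 / m) := by
  classical
  have : NeZero m := ⟨by omega⟩
  have hm0 : (0 : ℝ) < m := by exact_mod_cast NeZero.pos m
  have hn0 : (0 : ℝ) < n := by exact_mod_cast hn
  have hl1 := one_le_log_natCast hm
  set ℓ := Real.log m with hℓ
  choose N hN1 hN2 hN0 hN3 using exists_net_fhat (m := m) hn h hm (show 1 ≤ R by linarith)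
  set B := 8 * Real.sqrt m * Real.exp (-(θ ^ 2 / 16)) with hB
  set t := 512 * R * Real.sqrt n * ℓ with ht
  have ht0 : 0 ≤ t := by positivity
  set P : ℕ → Finset ((Fin n → ℂ) × (Fin n → ℂ)) := fun i =>
    ((N i) ×ˢ (N (i + 1))).filter fun q =>
      ∀ ψ : AddChar (Fin m) ℂ, ‖fhat ψ (pad m (q.2 - q.1))‖ ≤ 64 * Real.sqrt n / R ^ i with hP
  set E : (Fin n → ℂ) × (Fin n → ℂ) → Set (Fin m → ℂ) := fun q =>
    {a | B + t ≤ softNorm θ (cconv a (pad m (q.2 - q.1)))} with hE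
  have hEle : ∀ i, ∀ q ∈ P i, cgaussianVec m 1 (E q) ≤
      ENNReal.ofReal (3 * Real.exp (-(16 * ℓ ^ 2 * R ^ (2 * i + 2)))) := by
    intro i q hq
    obtain ⟨hq1, hq2⟩ := Finset.mem_filter.1 hq
    obtain ⟨hqa, hqb⟩ := Finset.mem_product.1 hq1
    have hcn : ∑ l, ‖pad m (q.2 - q.1) l‖ ^ 2 ≤ 4 := by
      rw [sum_norm_sq_pad h, ← cnorm_sq]
      have := cnorm_sub_le q.2 q.1
      have h1 := hN2 _ _ hqa
      have h2 := hN2 _ _ hqb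
      nlinarith [cnorm_nonneg (q.2 - q.1)]
    refine (measure_softNorm_cconv_ge _ hcn (by positivity) hq2 hθ ht0).trans_eq ?_
    congr 4
    rw [ht, mul_pow, mul_pow, mul_pow, div_pow, mul_pow, Real.sq_sqrt hn0.le]
    field_simp
    ring
  have hcard : ∀ i, ((P i).card : ℝ) ≤ Real.exp (8 * ℓ ^ 2 * R ^ (2 * i)) *
      Real.exp (8 * ℓ ^ 2 * R ^ (2 * (i + 1))) := by
    intro i
    calc ((P i).card : ℝ) ≤ (N i).card * (N (i + 1)).card := by
          exact_mod_cast (Finset.card_filter_le _ _).trans_eq (Finset.card_product _ _)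
      _ ≤ _ := by gcongr <;> apply hN1
  have hUi : ∀ i, cgaussianVec m 1 (⋃ q ∈ P i, E q) ≤ ENNReal.ofReal (3 / (m : ℝ) ^ 2) := by
    intro i
    refine (measure_biUnion_finset_le _ _).trans ((Finset.sum_le_sum (hEle i)).trans ?_)
    rw [Finset.sum_const, nsmul_eq_mul, ← ENNReal.ofReal_natCast,
      ← ENNReal.ofReal_mul (by positivity)]
    refine ENNReal.ofReal_le_ofReal ?_
    calc _ ≤ Real.exp (8 * ℓ ^ 2 * R ^ (2 * i)) * Real.exp (8 * ℓ ^ 2 * R ^ (2 * (i + 1))) *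
          (3 * Real.exp (-(16 * ℓ ^ 2 * R ^ (2 * i + 2)))) := by gcongr; exact hcard i
      _ = 3 * Real.exp (8 * ℓ ^ 2 * R ^ (2 * i) + 8 * ℓ ^ 2 * R ^ (2 * (i + 1)) +
          -(16 * ℓ ^ 2 * R ^ (2 * i + 2))) := by rw [Real.exp_add, Real.exp_add]; ring
      _ ≤ 3 * Real.exp (-(2 * ℓ)) := by
          gcongr
          have h1 : 1 ≤ R ^ (2 * i) := one_le_pow₀ (by linarith)
          have h2 : R ^ (2 * (i + 1)) = R ^ (2 * i) * R ^ 2 := by ring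
          have h3 : R ^ (2 * i + 2) = R ^ (2 * i) * R ^ 2 := by ring
          rw [h2, h3]
          have h4 : 4 ≤ R ^ 2 := by nlinarith
          have h5 : R ^ (2 * i) * 4 ≤ R ^ (2 * i) * R ^ 2 := by gcongr
          have h6 : ℓ ≤ ℓ ^ 2 := by nlinarith
          nlinarith
      _ = _ := by
          rw [Real.exp_neg, mul_comm 2 ℓ, Real.exp_mul, hℓ, Real.exp_log hm0]
          norm_cast
  have hsub : {a | ¬ ∀ w : Fin n → ℂ, cnorm w ≤ 1 →
        softNorm (J * θ) ((Amat h a).mulVec w) ≤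
          J * (B + t) + 64 * Real.sqrt n * Real.sqrt m / R ^ J} ⊆
      (⋃ i ∈ Finset.range J, ⋃ q ∈ P i, E q) ∪ {a | 4 * (m : ℝ) ≤ ∑ l, ‖a l‖ ^ 2} := by
    intro a ha
    by_contra hcon
    rw [Set.mem_union, not_or] at hcon
    obtain ⟨hc1, hc2⟩ := hcon
    refine ha fun w hw => ?_
    simp only [Set.mem_iUnion, not_exists] at hc1
    have hc2' : ∑ l, ‖a l‖ ^ 2 ≤ 4 * m := (not_le.1 hc2).le
    have hca : cnorm a ≤ 2 * Real.sqrt m := by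
      refine Real.sqrt_le_iff.2 ⟨by positivity, ?_⟩
      rw [mul_pow, Real.sq_sqrt hm0.le]
      linarith
    choose π hπ1 hπ2 using fun i => hN3 i w hw
    have hA : (Amat h a).mulVec w = cconv a (pad m w) := funext fun k => Amat_mulVec h a w k
    have hind : ∀ j ≤ J, softNorm (j * θ) (cconv a (pad m (π j))) ≤ j * (B + t) := by
      intro j
      induction j with
      | zero =>
        intro _
        rw [hN0 0 rfl _ (hπ1 0)]
        have : cconv a (pad m (0 : Fin n → ℂ)) = 0 := by
          ext k; simp [cconv, pad]
        simp [this, softNorm_zero_left, cnorm]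
      | succ j ih =>
        intro hj
        have h1 := ih (by omega)
        have hmem : (π j, π (j + 1)) ∈ P j := by
          refine Finset.mem_filter.2 ⟨Finset.mem_product.2 ⟨hπ1 j, hπ1 (j + 1)⟩, fun ψ => ?_⟩
          have h2 : pad m (π (j + 1) - π j) = pad m (w - π j) - pad m (w - π (j + 1)) := by
            rw [← pad_sub]; congr 1; abel
          rw [h2, fhat_sub]
          refine (norm_sub_le _ _).trans ?_
          have h3 := hπ2 j ψ
          have h4 := hπ2 (j + 1) ψ
          have h5 : 32 * Real.sqrt n / R ^ (j + 1) ≤ 32 * Real.sqrt n / R ^ j := by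
            gcongr
            · linarith
            · omega
          have h6 : 64 * Real.sqrt n / R ^ j = 2 * (32 * Real.sqrt n / R ^ j) := by ring
          rw [h6]
          linarith
        have h7 := hc1 j (Finset.mem_range.2 (by omega)) _ hmem
        have h8 : softNorm θ (cconv a (pad m (π (j + 1) - π j))) ≤ B + t := (not_le.1 h7).le
        have h9 : cconv a (pad m (π (j + 1))) =
            cconv a (pad m (π j)) + cconv a (pad m (π (j + 1) - π j)) := by
          rw [← cconv_add_right, pad_sub, add_sub_cancel]
        rw [h9]
        push_cast
        rw [add_mul, one_mul]
        refine (softNorm_add_le _ _ _ _).trans ?_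
        linarith
    have h9 : cconv a (pad m w) = cconv a (pad m (π J)) + cconv a (pad m (w - π J)) := by
      rw [← cconv_add_right, pad_sub, add_sub_cancel]
    rw [hA, h9, ← add_zero ((J : ℝ) * θ)]
    refine (softNorm_add_le _ _ _ _).trans (add_le_add (hind J le_rfl) ?_)
    rw [softNorm_zero_left]
    refine (cnorm_cconv_le (by positivity) _ (hπ2 J) a).trans ?_
    calc _ ≤ 32 * Real.sqrt n / R ^ J * (2 * Real.sqrt m) := by gcongr
      _ = _ := by ring
  refine (measure_mono hsub).trans ((measure_union_le _ _).trans ?_)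
  rw [ENNReal.ofReal_add (by positivity) (by positivity)]
  refine add_le_add ?_ (cgaussianVec_norm_sq_tail (NeZero.pos m))
  refine (measure_biUnion_finset_le _ _).trans ((Finset.sum_le_sum fun i _ => hUi i).trans_eq ?_)
  rw [Finset.sum_const, Finset.card_range, nsmul_eq_mul, ← ENNReal.ofReal_natCast,
    ← ENNReal.ofReal_mul (by positivity)]
  congr 1
  ring

/-! ### Rows on which `A w` dominates `A x` -/

lemma measure_card_small_Amat_le {n m : ℕ} (h : n ≤ m) (hm : 4 ≤ m) (x : Fin n → ℂ)
    (hx : cnorm x = 1) {τ : ℝ} (hτ : 0 ≤ τ) :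
    cgaussianVec m 1 {a | 3 * (4 * n * Real.log m + 4 * m * τ ^ 2) ≤
        ((Finset.univ.filter fun k => ‖(Amat h a).mulVec x k‖ ≤ τ).card : ℝ)} ≤
      ENNReal.ofReal (1 / m) := by
  have : NeZero m := ⟨by omega⟩
  have hm0 : (0 : ℝ) < m := by exact_mod_cast NeZero.pos m
  have hl1 := one_le_log_natCast hm
  have hn : 0 < n := by
    rcases Nat.eq_zero_or_pos n with rfl | hn
    · simp [cnorm] at hx
    · exact hn
  have hn0 : (0 : ℝ) < n := by exact_mod_cast hn
  set V : Fin m → Fin m → ℂ := fun k l => pad m x (k - l) with hV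
  have hVA : ∀ k a, linForm V k a = cconv a (pad m x) k := fun k a => by rw [cconv_comm]; rfl
  have hfhat : ∀ ψ : AddChar (Fin m) ℂ, ‖fhat ψ (pad m x)‖ ≤ Real.sqrt n := fun ψ => by
    simpa [hx] using norm_fhat_pad_le h ψ x
  have h1 := measure_card_small_le V n hn0
    (fun k => by
      simp only [hV]
      rw [sum_norm_sq_shift (pad m x) k, sum_norm_sq_pad h, ← cnorm_sq, hx, one_pow])
    (fun e he => by
      simp only [hVA]
      rw [← cnorm_sq]
      have h2 := cnorm_cconv_le (Real.sqrt_nonneg n) (pad m x) hfhat e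
      rw [show cnorm e = 1 by rw [cnorm, he, Real.sqrt_one], mul_one] at h2
      calc _ ≤ Real.sqrt n ^ 2 := by gcongr; exact cnorm_nonneg _
        _ = n := Real.sq_sqrt hn0.le)
    τ hτ ⌈Real.log m⌉₊ (Nat.ceil_pos.2 (by linarith))
  refine (measure_mono ?_).trans (h1.trans ?_)
  · intro a ha
    have ha' : 3 * (4 * n * Real.log m + 4 * m * τ ^ 2) ≤
        ((Finset.univ.filter fun k => ‖(Amat h a).mulVec x k‖ ≤ τ).card : ℝ) := ha
    simp only [Amat_mulVec, ← hVA] at ha'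
    refine le_trans ?_ ha'
    have h3 : (⌈Real.log m⌉₊ : ℝ) ≤ 2 * Real.log m := by
      have := (Nat.ceil_lt_add_one (show 0 ≤ Real.log m by linarith)).le
      linarith
    have h4 : Real.exp 1 ≤ 3 := by linarith [Real.exp_one_lt_d9]
    calc _ ≤ 3 * (2 * n * (2 * Real.log m) + 4 * m * τ ^ 2) := by gcongr
      _ = _ := by ring
  · refine ENNReal.ofReal_le_ofReal ?_
    rw [one_div, ← Real.exp_log (inv_pos.2 hm0), Real.log_inv]
    exact Real.exp_le_exp.2 (neg_le_neg (Nat.le_ceil _))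

/-- The conclusion of `indicator_bound` for a fixed `a`. -/
def IndicatorBound {n m : ℕ} (h : n ≤ m) (x : Fin n → ℂ) (γ δ : ℝ) (a : Fin m → ℂ) : Prop :=
  ∀ w : Fin n → ℂ, cnorm w ≤ γ →
    cnorm (fun k => (Amat h a).mulVec x k *
        if ‖(Amat h a).mulVec x k‖ ≤ ‖(Amat h a).mulVec w k‖ then 1 else 0) ≤
      δ * Real.sqrt m * cnorm w

lemma indicatorBound_of_softNorm_le {n m : ℕ} (h : n ≤ m) (x : Fin n → ℂ) {γ δ Θ : ℝ}
    (hδ : 0 ≤ δ) (hΘ : 0 ≤ Θ) (a : Fin m → ℂ)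
    (hsoft : ∀ w : Fin n → ℂ, cnorm w ≤ 1 →
      softNorm Θ ((Amat h a).mulVec w) ≤ δ * Real.sqrt m / 4)
    (hcard : Θ ^ 2 * ((Finset.univ.filter fun k => ‖(Amat h a).mulVec x k‖ ≤
      2 * Θ * γ).card : ℝ) ≤ δ ^ 2 * m / 4) :
    IndicatorBound h x γ δ a := by
  intro w hw
  set r := cnorm w with hr
  have hr0 : 0 ≤ r := cnorm_nonneg w
  set y := (Amat h a).mulVec w with hy
  set z := (Amat h a).mulVec x with hz
  have hsw : softNorm (r * Θ) y ≤ r * (δ * Real.sqrt m / 4) := by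
    rcases hr0.eq_or_lt with h0 | h0
    · have hw0 : w = 0 := by
        ext i
        exact norm_le_zero_iff.1 ((norm_le_cnorm w i).trans_eq (hr.symm.trans h0.symm))
      rw [← h0, hy, hw0, zero_mul, zero_mul, Matrix.mulVec_zero, softNorm_zero_left]
      simp [cnorm]
    · have hrc : (r : ℂ) ≠ 0 := by exact_mod_cast h0.ne'
      have hnr : ‖(r : ℂ)‖ = r := by
        rw [Complex.norm_real, Real.norm_eq_abs, abs_of_pos h0]
      have h1 : y = (r : ℂ) • (Amat h a).mulVec ((r : ℂ)⁻¹ • w) := by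
        rw [Matrix.mulVec_smul, smul_smul, mul_inv_cancel₀ hrc, one_smul]
      have h2 := softNorm_smul Θ (r : ℂ) ((Amat h a).mulVec ((r : ℂ)⁻¹ • w))
      rw [hnr, ← h1] at h2
      rw [h2]
      refine mul_le_mul_of_nonneg_left (hsoft _ ?_) hr0
      rw [cnorm_smul, norm_inv, hnr, ← hr, inv_mul_cancel₀ h0.ne']
  set T := Finset.univ.filter fun k => ‖z k‖ ≤ 2 * Θ * γ with hT
  have hpt : ∀ k, ‖z k * if ‖z k‖ ≤ ‖y k‖ then (1 : ℂ) else 0‖ ≤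
      (2 * max (‖y k‖ - r * Θ) 0) + r * Θ * (if k ∈ T then 1 else 0) := by
    intro k
    have hm1 := le_max_left (‖y k‖ - r * Θ) 0
    have hm2 := le_max_right (‖y k‖ - r * Θ) 0
    have hrΘ : 0 ≤ r * Θ := by positivity
    by_cases h1 : ‖z k‖ ≤ ‖y k‖
    · rw [if_pos h1, mul_one]
      by_cases h2 : k ∈ T
      · rw [if_pos h2]; linarith
      · rw [if_neg h2]
        have h3 : 2 * Θ * γ < ‖z k‖ := by simpa [hT] using h2
        have h4 : Θ * r ≤ Θ * γ := by gcongr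
        linarith
    · rw [if_neg h1, mul_zero, norm_zero]
      have : (0 : ℝ) ≤ if k ∈ T then 1 else 0 := by split_ifs <;> norm_num
      positivity
  have hTn : rnorm (fun k => r * Θ * (if k ∈ T then 1 else 0)) ≤ r * (δ * Real.sqrt m / 2) := by
    rw [rnorm_const_mul (by positivity), mul_assoc]
    refine mul_le_mul_of_nonneg_left ?_ hr0
    refine le_of_sq_le_sq ?_ (by positivity)
    rw [mul_pow, rnorm_sq, div_pow, mul_pow, Real.sq_sqrt (by positivity)]
    have : ∑ k, (if k ∈ T then (1 : ℝ) else 0) ^ 2 = T.card := by simp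
    rw [this]
    exact hcard.trans_eq (by ring)
  calc _ = rnorm (fun k => ‖z k * if ‖z k‖ ≤ ‖y k‖ then (1 : ℂ) else 0‖) := rfl
    _ ≤ rnorm ((fun k => 2 * max (‖y k‖ - r * Θ) 0) +
          fun k => r * Θ * (if k ∈ T then 1 else 0)) :=
        rnorm_mono (fun _ => norm_nonneg _) hpt
    _ ≤ 2 * softNorm (r * Θ) y + r * (δ * Real.sqrt m / 2) := by
        refine (rnorm_add_le _ _).trans (add_le_add ?_ hTn)
        rw [rnorm_const_mul (by norm_num)]; rfl
    _ ≤ δ * Real.sqrt m * r := by linarith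

lemma measure_not_indicatorBound_le {n m : ℕ} (h : n ≤ m) (hm : 4 ≤ m) (x : Fin n → ℂ)
    (hx : cnorm x = 1) {γ δ R θ : ℝ} (hγ : 0 ≤ γ) (hδ : 0 ≤ δ) (hR : 2 ≤ R) (hθ : 0 ≤ θ) (J : ℕ)
    (hsup : J * (8 * Real.sqrt m * Real.exp (-(θ ^ 2 / 16)) +
        512 * R * Real.sqrt n * Real.log m) + 64 * Real.sqrt n * Real.sqrt m / R ^ J ≤
      δ * Real.sqrt m / 4)
    (hcard : (J * θ) ^ 2 * (3 * (4 * n * Real.log m + 4 * m * (2 * (J * θ) * γ) ^ 2)) ≤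
      δ ^ 2 * m / 4) :
    cgaussianVec m 1 {a | ¬ IndicatorBound h x γ δ a} ≤
      ENNReal.ofReal (3 * J / (m : ℝ) ^ 2 + 1 / m + 1 / m) := by
  have hn : 0 < n := by
    rcases Nat.eq_zero_or_pos n with rfl | hn
    · simp [cnorm] at hx
    · exact hn
  rw [ENNReal.ofReal_add (by positivity) (by positivity)]
  refine (measure_mono ?_).trans ((measure_union_le _ _).trans (add_le_add
    (measure_softNorm_sup_le hn h hm hR hθ J)
    (measure_card_small_Amat_le h hm x hx (τ := 2 * (J * θ) * γ) (by positivity))))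
  intro a ha
  by_contra hcon
  rw [Set.mem_union, not_or] at hcon
  obtain ⟨h1, h2⟩ := hcon
  refine ha (indicatorBound_of_softNorm_le h x hδ (by positivity : 0 ≤ J * θ) a
    (fun w hw => ((not_not.1 h1) w hw).trans hsup) (le_trans ?_ hcard))
  gcongr
  exact (not_le.1 h2).le

lemma measure_not_indicatorBound_le_of_small {n m : ℕ} (h : n ≤ m) (x : Fin n → ℂ)
    (hx : cnorm x = 1) {γ δ : ℝ} (hγ : 0 ≤ γ) (hδ : 0 ≤ δ) (hm : 0 < m) :
    cgaussianVec m 1 {a | ¬ IndicatorBound h x γ δ a} ≤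
      ENNReal.ofReal (8 * m * n * Real.log m * γ ^ 2 + 2 / m) := by
  have hm0 : (0 : ℝ) < m := by exact_mod_cast hm
  have hl0 : 0 ≤ Real.log m := Real.log_natCast_nonneg m
  set s := 2 * Real.sqrt (Real.log m) with hs
  set τ := Real.sqrt n * γ * s with hτ
  have hτ0 : 0 ≤ τ := by positivity
  have hbig : cgaussianVec m 1 (⋃ l, {a | s ^ 2 ≤ ‖a l‖ ^ 2}) ≤ ENNReal.ofReal (2 / m) := by
    refine (measure_iUnion_le _).trans ?_
    rw [tsum_fintype]
    have h1 : ∀ l, cgaussianVec m 1 {a | s ^ 2 ≤ ‖a l‖ ^ 2} ≤ ENNReal.ofReal (2 / m ^ 2) := by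
      intro l
      have h2 := cgaussianVec_linearForm_tail (m := m) (Pi.single l 1) (s := 1) one_pos
        (by simp [Pi.single_apply, apply_ite]) (s ^ 2)
      simp only [Pi.single_apply, ite_mul, one_mul, zero_mul, Finset.sum_ite_eq',
        Finset.mem_univ, if_true] at h2
      refine h2.trans (ENNReal.ofReal_le_ofReal (le_of_eq ?_))
      rw [hs, mul_pow, Real.sq_sqrt hl0, show (2 : ℝ) ^ 2 * Real.log m / (2 * 1) =
        Real.log m * 2 by ring, Real.exp_neg, Real.exp_mul, Real.exp_log hm0]
      norm_cast
    refine (Finset.sum_le_sum fun l _ => h1 l).trans_eq ?_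
    rw [Finset.sum_const, Finset.card_univ, Fintype.card_fin, nsmul_eq_mul,
      ← ENNReal.ofReal_natCast, ← ENNReal.ofReal_mul hm0.le]
    congr 1
    field_simp
  have hsmall : cgaussianVec m 1 (⋃ k, {a | ‖(Amat h a).mulVec x k‖ ≤ τ}) ≤
      ENNReal.ofReal (8 * m * n * Real.log m * γ ^ 2) := by
    refine (measure_iUnion_le _).trans ?_
    rw [tsum_fintype]
    have h1 : ∀ k, cgaussianVec m 1 {a | ‖(Amat h a).mulVec x k‖ ≤ τ} ≤
        ENNReal.ofReal (2 * τ ^ 2) := by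
      intro k
      have h2 := cgaussian_small_ball 1 0 one_ne_zero τ hτ0
      rw [← map_linearForm_cgaussianVec (fun l => pad m x (k - l)) (by
        rw [sum_norm_sq_shift (pad m x) k, sum_norm_sq_pad h, ← cnorm_sq, hx, one_pow]),
        Measure.map_apply (by fun_prop) (measurableSet_le (by fun_prop) (by fun_prop))] at h2
      simp only [one_mul, add_zero, norm_one, one_pow, div_one, Set.preimage_ofPred_eq] at h2
      simpa only [Amat_mulVec, cconv_comm] using h2
    refine (Finset.sum_le_sum fun l _ => h1 l).trans_eq ?_
    rw [Finset.sum_const, Finset.card_univ, Fintype.card_fin, nsmul_eq_mul,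
      ← ENNReal.ofReal_natCast, ← ENNReal.ofReal_mul hm0.le]
    congr 1
    rw [hτ, hs, mul_pow, mul_pow, mul_pow, Real.sq_sqrt hl0, Real.sq_sqrt (by positivity)]
    ring
  rw [ENNReal.ofReal_add (by positivity) (by positivity)]
  refine (measure_mono ?_).trans ((measure_union_le _ _).trans (add_le_add hsmall hbig))
  intro a ha
  by_contra hcon
  simp only [Set.mem_union, not_or, Set.mem_iUnion, not_exists, Set.mem_ofPred_eq, not_le] at hcon
  obtain ⟨h1, h2⟩ := hcon
  refine ha fun w hw => ?_
  have h3 : ∀ l, ‖a l‖ ≤ s := fun l =>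
    (lt_of_pow_lt_pow_left₀ 2 (by positivity) (h2 l)).le
  have h4 : ∀ k, ¬ ‖(Amat h a).mulVec x k‖ ≤ ‖(Amat h a).mulVec w k‖ := by
    intro k hk
    have h5 : ‖(Amat h a).mulVec w k‖ ≤ τ := by
      calc ‖(Amat h a).mulVec w k‖ ≤ ∑ j, ‖w j‖ * s := by
            rw [Amat_mulVec, cconv, sum_pad h w (fun i z => a (k - i) * z) (by simp)]
            refine (norm_sum_le _ _).trans (Finset.sum_le_sum fun j _ => ?_)
            rw [norm_mul, mul_comm]
            gcongr
            exact h3 _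
        _ = (∑ j, ‖w j‖) * s := by rw [Finset.sum_mul]
        _ ≤ Real.sqrt n * cnorm w * s := by gcongr; exact sum_norm_le_sqrt w
        _ ≤ τ := by rw [hτ]; gcongr
    linarith [h1 k]
  have h6 : cnorm (fun k => (Amat h a).mulVec x k *
      if ‖(Amat h a).mulVec x k‖ ≤ ‖(Amat h a).mulVec w k‖ then 1 else 0) = 0 := by
    simp [h4, cnorm]
  rw [h6]
  have := cnorm_nonneg w
  positivity

/-! ### Choice of parameters -/

lemma measure_not_indicatorBound_le_of_large {n m : ℕ} (h : n ≤ m) (hm : 4 ≤ m) (x : Fin n → ℂ)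
    (hx : cnorm x = 1) {γ δ : ℝ} (hγ : 0 ≤ γ) (hδ : 0 < δ) (hn : 1 ≤ n)
    (hmn : 10 ^ 8 * (n * Real.log m ^ 4) ≤ δ ^ 2 * m)
    (hγl : γ ^ 2 * Real.log m ^ 6 ≤ δ ^ 2 / 10 ^ 7) :
    cgaussianVec m 1 {a | ¬ IndicatorBound h x γ δ a} ≤ ENNReal.ofReal (8 / m) := by
  have hm4 : (4 : ℝ) ≤ m := by exact_mod_cast hm
  have hm0 : (0 : ℝ) < m := by linarith
  have hn1 : (1 : ℝ) ≤ n := by exact_mod_cast hn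
  have hl1 := one_le_log_natCast hm
  have hlm : Real.log m ≤ m := (Real.log_le_sub_one_of_pos hm0).trans (by linarith)
  set ℓ := Real.log m with hℓ
  set J := ⌈ℓ⌉₊ with hJ
  have hJl : (J : ℝ) ≤ 2 * ℓ := by
    have := (Nat.ceil_lt_add_one (show 0 ≤ ℓ by linarith)).le
    linarith
  have hθ : (4 * Real.sqrt ℓ) ^ 2 = 16 * ℓ := by
    rw [mul_pow, Real.sq_sqrt (by linarith)]; norm_num
  set S := Real.sqrt m with hS
  have hS0 : 0 < S := by positivity
  have hSS : S ^ 2 = m := Real.sq_sqrt hm0.le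
  set N := Real.sqrt n with hN
  have hN1 : 1 ≤ N := Real.one_le_sqrt.2 hn1
  have hNN : N ^ 2 = n := Real.sq_sqrt (by linarith)
  have hJ2 : S ≤ 2 ^ J := by
    have h1 : Real.exp (ℓ / 2) ≤ 2 ^ J := by
      rw [← Real.exp_log (show (0 : ℝ) < 2 by norm_num), ← Real.exp_nat_mul]
      refine Real.exp_le_exp.2 ?_
      have h2 := Real.log_two_gt_d9
      have h3 : ℓ ≤ J := Nat.le_ceil _
      rw [Real.exp_log (by norm_num)]
      nlinarith
    have h2 : S = Real.exp (ℓ / 2) := by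
      rw [hS, Real.sqrt_eq_iff_mul_self_eq hm0.le (Real.exp_nonneg _), ← Real.exp_add, add_halves,
        hℓ, Real.exp_log hm0]
    rw [h2]; exact h1
  have hkey : 10 ^ 4 * (N * ℓ ^ 2) ≤ δ * S := by
    refine le_of_sq_le_sq ?_ (by positivity)
    rw [mul_pow, mul_pow, mul_pow, hNN, hSS]
    exact le_of_eq_of_le (by ring) hmn
  refine (measure_not_indicatorBound_le h hm x hx hγ hδ.le (R := 2) (θ := 4 * Real.sqrt ℓ) le_rfl
    (by positivity) J ?_ ?_).trans (ENNReal.ofReal_le_ofReal ?_)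
  · rw [hθ, show 16 * ℓ / 16 = ℓ by ring, Real.exp_neg, hℓ, Real.exp_log hm0, ← hℓ]
    have h1 : 8 * S * (m : ℝ)⁻¹ ≤ 8 := by
      rw [← div_eq_mul_inv, div_le_iff₀ hm0, ← hSS]
      nlinarith [Real.one_le_sqrt.2 (show (1 : ℝ) ≤ m by linarith)]
    have h2 : 64 * N * S / 2 ^ J ≤ 64 * N := by
      rw [div_le_iff₀ (by positivity)]; gcongr
    have h3 : 1 ≤ N * ℓ := one_le_mul_of_one_le_of_one_le hN1 hl1
    calc _ ≤ 2 * ℓ * (8 + 512 * 2 * N * ℓ) + 64 * N := by gcongr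
      _ ≤ 2 * ℓ * (8 * (N * ℓ) + 512 * 2 * N * ℓ) + 64 * N * ℓ ^ 2 := by
          have h4 : 64 * N ≤ 64 * N * ℓ ^ 2 :=
            le_mul_of_one_le_right (by positivity) (one_le_pow₀ hl1)
          have h5 : 2 * ℓ * (8 + 512 * 2 * N * ℓ) ≤ 2 * ℓ * (8 * (N * ℓ) + 512 * 2 * N * ℓ) :=
            mul_le_mul_of_nonneg_left (by linarith) (by positivity)
          exact add_le_add h5 h4
      _ = 2128 * (N * ℓ ^ 2) := by ring
      _ ≤ δ * S / 4 := by
          have : 0 ≤ N * ℓ ^ 2 := by positivity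
          linarith
  · have h1 : (J * (4 * Real.sqrt ℓ)) ^ 2 ≤ 64 * ℓ ^ 3 := by
      rw [mul_pow, hθ]
      calc (J : ℝ) ^ 2 * (16 * ℓ) ≤ (2 * ℓ) ^ 2 * (16 * ℓ) := by gcongr
        _ = _ := by ring
    rw [mul_pow (2 * _) γ, mul_pow 2]
    calc _ ≤ 64 * ℓ ^ 3 * (3 * (4 * n * ℓ + 4 * m * (2 ^ 2 * (64 * ℓ ^ 3) * γ ^ 2))) := by gcongr
      _ = 768 * (n * ℓ ^ 4) + 196608 * (m * (γ ^ 2 * ℓ ^ 6)) := by ring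
      _ ≤ 768 * (δ ^ 2 * m / 10 ^ 8) + 196608 * (m * (δ ^ 2 / 10 ^ 7)) := by
          gcongr
          linarith
      _ ≤ _ := by
          have : 0 < δ ^ 2 * m := by positivity
          linarith
  · have : 3 * (J : ℝ) / m ^ 2 ≤ 6 / m := by
      rw [div_le_div_iff₀ (by positivity) hm0]
      nlinarith
    calc _ ≤ 6 / m + 1 / m + 1 / (m : ℝ) := by gcongr
      _ = _ := by ring

lemma measure_not_indicatorBound_le_of_moderate {n m : ℕ} (h : n ≤ m) (x : Fin n → ℂ)
    (hx : cnorm x = 1) {γ δ q : ℝ} (hγ : 0 ≤ γ) (hδ : 0 < δ) (hδ1 : δ < 1) (hn : 1 ≤ n)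
    (hq : 10 ^ 5 ≤ q) (hmq : (m : ℝ) = q ^ 40) (hlq : Real.log m ≤ 40 * q) (hnq : n ≤ q)
    (hδq : 1 ≤ δ * q ^ 8) (hγδ : γ ≤ δ ^ 3 / 10 ^ 8) :
    cgaussianVec m 1 {a | ¬ IndicatorBound h x γ δ a} ≤ ENNReal.ofReal (8 / m) := by
  have hq0 : 0 < q := by linarith
  have hm4 : (4 : ℝ) ≤ m := by
    rw [hmq]
    calc (4 : ℝ) ≤ q := by linarith
      _ ≤ q ^ 40 := le_self_pow₀ (by linarith) (by norm_num)
  have hm : 4 ≤ m := by exact_mod_cast hm4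
  have hm0 : (0 : ℝ) < m := by linarith
  have hn1 : (1 : ℝ) ≤ n := by exact_mod_cast hn
  have hl1 := one_le_log_natCast hm
  set ℓ := Real.log m with hℓ
  have hS : Real.sqrt m = q ^ 20 := by
    rw [hmq, show q ^ 40 = (q ^ 20) ^ 2 by ring, Real.sqrt_sq (by positivity)]
  have hnl : n * ℓ ≤ 40 * q ^ 2 := by
    calc n * ℓ ≤ q * (40 * q) := by gcongr
      _ = _ := by ring
  have hq4 : 10 ^ 10 * q ^ 2 ≤ q ^ 4 := by
    have : (10 ^ 5 : ℝ) ^ 2 ≤ q ^ 2 := by gcongr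
    calc (10 : ℝ) ^ 10 * q ^ 2 = (10 ^ 5) ^ 2 * q ^ 2 := by ring
      _ ≤ q ^ 2 * q ^ 2 := by gcongr
      _ = q ^ 4 := by ring
  set N := Real.sqrt n with hN
  have hN1 : 1 ≤ N := Real.one_le_sqrt.2 hn1
  have hNN : N ^ 2 = n := Real.sq_sqrt (by linarith)
  have hlog : 0 ≤ Real.log (128 / δ) := Real.log_nonneg (by rw [le_div_iff₀ hδ]; linarith)
  have hθ : Real.sqrt (16 * Real.log (128 / δ)) ^ 2 = 16 * Real.log (128 / δ) :=
    Real.sq_sqrt (by positivity)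
  refine (measure_not_indicatorBound_le h hm x hx hγ hδ.le (R := 1024 * N / δ)
    (θ := Real.sqrt (16 * Real.log (128 / δ))) ?_ (Real.sqrt_nonneg _) 1 ?_ ?_).trans
    (ENNReal.ofReal_le_ofReal ?_)
  · rw [le_div_iff₀ hδ]; linarith
  · rw [hθ, mul_div_cancel_left₀ _ (by norm_num), Real.exp_neg, Real.exp_log (by positivity), hS,
      pow_one, Nat.cast_one, one_mul, inv_div]
    have h1 : 512 * (1024 * N / δ) * N * ℓ ≤ δ * q ^ 20 / 16 := by
      rw [show 512 * (1024 * N / δ) * N * ℓ = 524288 * (N ^ 2 * ℓ) / δ by ring, hNN,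
        div_le_iff₀ hδ]
      have h2 : 1 ≤ (δ * q ^ 8) ^ 2 := one_le_pow₀ hδq
      have h3 : q ^ 4 ≤ δ * q ^ 20 * δ := by
        calc q ^ 4 = 1 * q ^ 4 := (one_mul _).symm
          _ ≤ (δ * q ^ 8) ^ 2 * q ^ 4 := by gcongr
          _ = _ := by ring
      have := sq_nonneg q
      linarith
    have h4 : 64 * N * q ^ 20 / (1024 * N / δ) = δ * q ^ 20 / 16 := by field_simp; norm_num
    rw [h4]
    have : 0 < δ * q ^ 20 := by positivity
    linarith
  · rw [Nat.cast_one, one_mul, mul_pow (2 * _) γ, mul_pow 2, hθ]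
    have hQ : 16 * Real.log (128 / δ) ≤ 2048 / δ := by
      have := Real.log_le_sub_one_of_pos (show 0 < 128 / δ by positivity)
      have h2 : 2048 / δ = 16 * (128 / δ) := by ring
      linarith
    have h1 : 24576 * (n * ℓ) / δ ≤ δ ^ 2 * m / 8 := by
      rw [div_le_iff₀ hδ, hmq]
      have h2 : 1 ≤ (δ * q ^ 8) ^ 3 := one_le_pow₀ hδq
      have h3 : q ^ 4 ≤ δ ^ 2 * q ^ 40 * δ := by
        calc q ^ 4 = 1 * q ^ 4 := (one_mul _).symm
          _ ≤ (δ * q ^ 8) ^ 3 * q ^ 16 := by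
              gcongr
              · linarith
              · norm_num
          _ = _ := by ring
      have := sq_nonneg q
      linarith
    calc _ ≤ 2048 / δ * (3 * (4 * n * ℓ + 4 * m * (2 ^ 2 * (2048 / δ) * (δ ^ 3 / 10 ^ 8) ^ 2))) := by
          gcongr
      _ = 24576 * (n * ℓ) / δ + 48 * 2048 ^ 2 / 10 ^ 16 * δ ^ 2 * (δ ^ 2 * m) := by
          field_simp; ring
      _ ≤ δ ^ 2 * m / 8 + 48 * 2048 ^ 2 / 10 ^ 16 * 1 * (δ ^ 2 * m) := by
          gcongr
          exact pow_le_one₀ hδ.le hδ1.le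
      _ ≤ _ := by
          have : 0 < δ ^ 2 * m := by positivity
          linarith
  · have : 3 * ((1 : ℕ) : ℝ) / m ^ 2 ≤ 6 / m := by
      rw [div_le_div_iff₀ (by positivity) hm0]
      push_cast
      nlinarith
    calc _ ≤ 6 / m + 1 / m + 1 / (m : ℝ) := by gcongr
      _ = _ := by ring

lemma measure_not_indicatorBound_le_of_tiny {n m : ℕ} (h : n ≤ m) (x : Fin n → ℂ)
    (hx : cnorm x = 1) {γ δ q : ℝ} (hγ : 0 ≤ γ) (hδ : 0 < δ)
    (hq : 10 ^ 5 ≤ q) (hmq : (m : ℝ) = q ^ 40) (hlq : Real.log m ≤ 40 * q) (hnq : n ≤ q)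
    (hδq : δ * q ^ 8 ≤ 1) (hγδ : γ ≤ δ ^ 3 / 10 ^ 8) :
    cgaussianVec m 1 {a | ¬ IndicatorBound h x γ δ a} ≤ ENNReal.ofReal (10 / q) := by
  have hq0 : 0 < q := by linarith
  have hm0 : (0 : ℝ) < m := by rw [hmq]; positivity
  have hl0 : 0 ≤ Real.log m := Real.log_natCast_nonneg m
  refine (measure_not_indicatorBound_le_of_small h x hx hγ hδ.le (by exact_mod_cast hm0)).trans
    (ENNReal.ofReal_le_ofReal ?_)
  have h1 : 8 * m * n * Real.log m * γ ^ 2 ≤ 1 / q := by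
    rw [le_div_iff₀ hq0]
    calc 8 * m * n * Real.log m * γ ^ 2 * q
        ≤ 8 * q ^ 40 * q * (40 * q) * (δ ^ 3 / 10 ^ 8) ^ 2 * q := by
          rw [hmq] at hlq ⊢; gcongr
          rw [← hmq]; exact hl0
      _ = 320 / 10 ^ 16 * ((δ * q ^ 8) ^ 6 * (1 / q ^ 5)) := by field_simp; ring
      _ ≤ 320 / 10 ^ 16 * (1 ^ 6 * 1) := by
          gcongr
          rw [div_le_one (by positivity)]
          exact one_le_pow₀ (by linarith)
      _ ≤ 1 := by norm_num
  have h2 : 2 / (m : ℝ) ≤ 2 / q := by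
    gcongr
    rw [hmq]
    exact le_self_pow₀ (by linarith) (by norm_num)
  calc _ ≤ 1 / q + 2 / q := add_le_add h1 h2
    _ = 3 / q := by ring
    _ ≤ 10 / q := by gcongr; norm_num

lemma measure_not_indicatorBound {n m : ℕ} (h : n ≤ m) (x : Fin n → ℂ) (hx : cnorm x = 1)
    {δ : ℝ} (hδ : 0 < δ) (hδ1 : δ < 1) (hn : 2 ≤ n)
    (hmn : 40 ^ 4 * 10 ^ 8 * ((δ ^ 2)⁻¹ * n * Real.log n ^ 4) ≤ m)
    (hm : (10 ^ 5 : ℝ) ≤ (m : ℝ) ^ (1 / 40 : ℝ)) :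
    cgaussianVec m 1 {a | ¬ IndicatorBound h x (1 / 10 ^ 9 * δ ^ 3 * (Real.log n ^ 6)⁻¹) δ a} ≤
      ENNReal.ofReal (10 / (m : ℝ) ^ (1 / 40 : ℝ)) := by
  have hn2 : (2 : ℝ) ≤ n := by exact_mod_cast hn
  have hmpos : (0 : ℝ) < m := by
    have : 0 < m := by omega
    exact_mod_cast this
  set q := (m : ℝ) ^ (1 / 40 : ℝ) with hq
  have hq0 : 0 < q := by positivity
  have hmq : (m : ℝ) = q ^ 40 := by
    rw [hq, ← Real.rpow_natCast, ← Real.rpow_mul hmpos.le]; norm_num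
  have hlq' : Real.log m = 40 * Real.log q := by rw [hmq, Real.log_pow]; norm_num
  have hlq : Real.log m ≤ 40 * q := by
    rw [hlq']
    linarith [Real.log_le_sub_one_of_pos hq0]
  have hqm : q ≤ m := by
    conv_rhs => rw [hmq]
    exact le_self_pow₀ (by linarith) (by norm_num)
  have hm4 : 4 ≤ m := by
    have : (4 : ℝ) ≤ m := by linarith
    exact_mod_cast this
  have hl1 := one_le_log_natCast hm4
  have hl2 : (69 / 100 : ℝ) ≤ Real.log n := by
    have := Real.log_le_log (by norm_num) hn2
    linarith [Real.log_two_gt_d9]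
  have hl6 : 1 / 10 ≤ Real.log n ^ 6 := by
    calc (1 / 10 : ℝ) ≤ (69 / 100) ^ 6 := by norm_num
      _ ≤ _ := by gcongr
  set γ := 1 / 10 ^ 9 * δ ^ 3 * (Real.log n ^ 6)⁻¹ with hγ
  have hγ0 : 0 ≤ γ := by positivity
  have hγδ : γ ≤ δ ^ 3 / 10 ^ 8 := by
    have : (Real.log n ^ 6)⁻¹ ≤ 10 := by
      rw [inv_le_comm₀ (by positivity) (by norm_num)]; linarith
    calc γ ≤ 1 / 10 ^ 9 * δ ^ 3 * 10 := by rw [hγ]; gcongr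
      _ = _ := by ring
  have h8 : ENNReal.ofReal (8 / m) ≤ ENNReal.ofReal (10 / q) := by
    refine ENNReal.ofReal_le_ofReal ?_
    gcongr
    norm_num
  rcases le_total q n with hqn | hnq
  · have hll : Real.log m ≤ 40 * Real.log n := by
      rw [hlq']
      gcongr
    refine (measure_not_indicatorBound_le_of_large h hm4 x hx hγ0 hδ (by omega) ?_ ?_).trans h8
    · calc 10 ^ 8 * (n * Real.log m ^ 4) ≤ 10 ^ 8 * (n * (40 * Real.log n) ^ 4) := by gcongr
        _ = δ ^ 2 * (40 ^ 4 * 10 ^ 8 * ((δ ^ 2)⁻¹ * n * Real.log n ^ 4)) := by field_simp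
        _ ≤ _ := by gcongr
    · calc γ ^ 2 * Real.log m ^ 6 ≤ γ ^ 2 * (40 * Real.log n) ^ 6 := by gcongr
        _ = 40 ^ 6 / 10 ^ 9 * δ ^ 3 * γ := by rw [hγ]; field_simp
        _ ≤ 40 ^ 6 / 10 ^ 9 * δ ^ 3 * (δ ^ 3 / 10 ^ 8) := by gcongr
        _ = 40 ^ 6 / 10 ^ 17 * δ ^ 2 * δ ^ 4 := by ring
        _ ≤ 40 ^ 6 / 10 ^ 17 * δ ^ 2 * 1 := by gcongr; exact pow_le_one₀ hδ.le hδ1.le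
        _ ≤ δ ^ 2 / 10 ^ 7 := by
            have := sq_nonneg δ
            linarith
  · rcases le_total 1 (δ * q ^ 8) with hδq | hδq
    · exact (measure_not_indicatorBound_le_of_moderate h x hx hγ0 hδ hδ1 (by omega) hm hmq hlq hnq
        hδq hγδ).trans h8
    · exact measure_not_indicatorBound_le_of_tiny h x hx hγ0 hδ hm hmq hlq hnq hδq hγδ

lemma indicatorBound_of_subsingleton {m : ℕ} (h : 1 ≤ m) (x : Fin 1 → ℂ) {γ δ : ℝ} (hγ : γ = 0)
    (a : Fin m → ℂ) : IndicatorBound h x γ δ a := by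
  intro w hw
  have hw0 : w = 0 := by
    ext i
    exact norm_le_zero_iff.1 (((norm_le_cnorm w i).trans hw).trans_eq hγ)
  have h1 : (fun k => (Amat h a).mulVec x k *
      if ‖(Amat h a).mulVec x k‖ ≤ ‖(Amat h a).mulVec w k‖ then 1 else 0) = 0 := by
    ext k
    simp +contextual [hw0]
  rw [h1, hw0]
  simp [cnorm]

/-- Lemma 5.3.
For `δ ∈ (0,1)` and `γ = c₀ δ³ (log n)⁻⁶`, whenever
`m ≥ C max{‖C_x‖² (log n)¹⁷, δ⁻² n (log n)⁴}`, with probability at least `1 − c₁ m^{−c₂}`,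
for every `w` with `‖w‖ ≤ γ` one has `‖(A x) ∘ 1_{|A w| ≥ |A x|}‖ ≤ δ √m ‖w‖`. -/
theorem indicator_bound :
    ∃ c₀ c₁ c₂ C : ℝ, 0 < c₀ ∧ 0 < c₁ ∧ 0 < c₂ ∧ 0 < C ∧
      ∀ (δ : ℝ), δ ∈ Set.Ioo (0 : ℝ) 1 →
      ∀ (n m : ℕ) (h : n ≤ m) (x : Fin n → ℂ), cnorm x = 1 →
        C * max (opNorm (Cx m x) ^ 2 * Real.log n ^ 17)
            ((δ ^ 2)⁻¹ * (n : ℝ) * Real.log n ^ 4) ≤ (m : ℝ) →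
        cgaussianVec m 1 {a | ∀ w : Fin n → ℂ,
            cnorm w ≤ c₀ * δ ^ 3 * (Real.log n ^ 6)⁻¹ →
            cnorm (fun k => (Amat h a).mulVec x k *
                if ‖(Amat h a).mulVec x k‖ ≤ ‖(Amat h a).mulVec w k‖ then 1 else 0) ≤
              δ * Real.sqrt m * cnorm w} ≥
          ENNReal.ofReal (1 - c₁ * (m : ℝ) ^ (-c₂)) := by
  refine ⟨1 / 10 ^ 9, 10 ^ 5, 1 / 40, 40 ^ 4 * 10 ^ 8, by norm_num, by norm_num, by norm_num,
    by norm_num, ?_⟩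
  rintro δ ⟨hδ, hδ1⟩ n m h x hx hC
  have hmn := (mul_le_mul_of_nonneg_left (le_max_right _ _) (by norm_num)).trans hC
  rcases Nat.lt_or_ge n 2 with hn | hn
  · interval_cases n
    · simp [cnorm] at hx
    · have h1 : ∀ a, IndicatorBound h x (1 / 10 ^ 9 * δ ^ 3 * (Real.log ((1 : ℕ) : ℝ) ^ 6)⁻¹) δ a :=
        indicatorBound_of_subsingleton h x (by simp)
      refine ge_iff_le.2 (le_trans ?_ (measure_mono (s := Set.univ) fun a _ => h1 a))
      rw [measure_univ]
      refine ENNReal.ofReal_le_one.2 ?_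
      have : (0 : ℝ) ≤ 10 ^ 5 * (m : ℝ) ^ (-(1 / 40) : ℝ) := by positivity
      linarith
  have hmpos : (0 : ℝ) < m := by
    have : 0 < m := by omega
    exact_mod_cast this
  rw [Real.rpow_neg hmpos.le]
  have hq0 : 0 < (m : ℝ) ^ (1 / 40 : ℝ) := by positivity
  rcases lt_or_ge ((m : ℝ) ^ (1 / 40 : ℝ)) (10 ^ 5) with hq | hq
  · rw [ENNReal.ofReal_of_nonpos]
    · exact zero_le
    · rw [sub_nonpos, ← div_eq_mul_inv, le_div_iff₀ hq0]
      linarith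
  · have hbad := measure_not_indicatorBound h x hx hδ hδ1 hn hmn hq
    have h1 : (1 : ℝ≥0∞) ≤
        cgaussianVec m 1 {a | IndicatorBound h x (1 / 10 ^ 9 * δ ^ 3 * (Real.log n ^ 6)⁻¹) δ a} +
        ENNReal.ofReal (10 / (m : ℝ) ^ (1 / 40 : ℝ)) := by
      rw [← measure_univ (μ := cgaussianVec m 1)]
      refine le_trans (measure_mono fun a _ => ?_) ((measure_union_le _ _).trans
        (add_le_add le_rfl hbad))
      exact em _
    rw [ENNReal.ofReal_sub _ (by positivity), ENNReal.ofReal_one]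
    refine ge_iff_le.2 (tsub_le_iff_right.2 (h1.trans (add_le_add le_rfl ?_)))
    refine ENNReal.ofReal_le_ofReal ?_
    rw [div_eq_mul_inv]
    gcongr
    norm_num

end ConvPR

end
end

section
/- For every ρ ∈ (0,1) and every z ∈ ℂ with |z| ≤ ρ, one has |1 − exp(iφ(1+z)) + i·Im(z)| ≤ ((2−ρ)/(1−ρ)²)·|z|². -/
open MeasureTheory ProbabilityTheory Matrix Complex
open scoped NNReal ENNReal

noncomputable section

namespace ConvPR

/-- Lemma A.2: first-order approximation of the phase.
For `ρ ∈ (0,1)` and `|z| ≤ ρ`,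
`|1 − exp(iφ(1+z)) + i Im(z)| ≤ ((2−ρ)/(1−ρ)²) |z|²`. -/
theorem phase_linearization (ρ : ℝ) (hρ : ρ ∈ Set.Ioo (0 : ℝ) 1) (z : ℂ) (hz : ‖z‖ ≤ ρ) :
    ‖1 - phase (1 + z) + Complex.I * (z.im : ℂ)‖ ≤ (2 - ρ) / (1 - ρ) ^ 2 * ‖z‖ ^ 2 := by
  obtain ⟨-, hρ1⟩ := hρ
  have ha : 0 < 1 - ρ := by linarith
  have hx : 1 - ρ ≤ 1 + z.re := by
    linarith [(abs_le.mp (Complex.abs_re_le_norm z)).1]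
  have hy : |z.im| ≤ ‖z‖ := Complex.abs_im_le_norm z
  have hz2 : ‖z‖ ^ 2 = z.re ^ 2 + z.im ^ 2 := by
    rw [Complex.sq_norm, Complex.normSq_apply]; ring
  have hN2 : ‖1 + z‖ ^ 2 = (1 + z.re) ^ 2 + z.im ^ 2 := by
    rw [Complex.sq_norm, Complex.normSq_apply]; simp; ring
  have hNge : 1 + z.re ≤ ‖1 + z‖ := by simpa using Complex.re_le_norm (1 + z)
  have hN1 : |‖1 + z‖ - 1| ≤ ‖z‖ := by
    simpa using abs_norm_sub_norm_le (1 + z) 1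
  have hw : 1 + z ≠ 0 := norm_pos_iff.mp (by linarith)
  set N := ‖1 + z‖ with hN
  have hNpos : 0 < N := by linarith
  have hNC : (N : ℂ) ≠ 0 := by exact_mod_cast hNpos.ne'
  have hphase : 1 - phase (1 + z) + Complex.I * (z.im : ℂ) =
      (((N - 1 - z.re : ℝ) : ℂ) + ((z.im * (N - 1) : ℝ) : ℂ) * Complex.I) / (N : ℂ) := by
    rw [phase, if_neg hw, ← hN, eq_div_iff hNC, add_mul, sub_mul, div_mul_cancel₀ _ hNC]
    push_cast
    linear_combination Complex.re_add_im z
  have hre : 2 * (1 - ρ) * |N - 1 - z.re| ≤ ‖z‖ ^ 2 := by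
    rw [abs_of_nonneg (by linarith)]
    nlinarith [mul_nonneg (sub_nonneg.mpr hNge) (show 0 ≤ N + (1 + z.re) - 2 * (1 - ρ) by linarith),
      sq_nonneg z.re]
  have him : |z.im * (N - 1)| ≤ ‖z‖ ^ 2 := by
    rw [abs_mul, sq]
    exact mul_le_mul hy hN1 (abs_nonneg _) (norm_nonneg _)
  have hnum : ‖((N - 1 - z.re : ℝ) : ℂ) + ((z.im * (N - 1) : ℝ) : ℂ) * Complex.I‖ ≤
      |N - 1 - z.re| + |z.im * (N - 1)| := by
    refine (norm_add_le _ _).trans_eq ?_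
    rw [norm_mul, Complex.norm_I, mul_one, Complex.norm_real, Complex.norm_real,
      Real.norm_eq_abs, Real.norm_eq_abs]
  have hsum : |N - 1 - z.re| + |z.im * (N - 1)| ≤ (2 - ρ) / (1 - ρ) * ‖z‖ ^ 2 := by
    rw [div_mul_eq_mul_div, le_div_iff₀ ha]
    nlinarith [mul_le_mul_of_nonneg_right him ha.le, sq_nonneg ‖z‖]
  rw [hphase, norm_div, Complex.norm_real, Real.norm_of_nonneg hNpos.le]
  calc _ ≤ ((2 - ρ) / (1 - ρ) * ‖z‖ ^ 2) / (1 - ρ) :=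
        div_le_div₀ (mul_nonneg (div_nonneg (by linarith) ha.le) (sq_nonneg _))
          (hnum.trans hsum) ha (hx.trans hNge)
    _ = (2 - ρ) / (1 - ρ) ^ 2 * ‖z‖ ^ 2 := by field_simp

end ConvPR

end
end
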